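/- arXiv:2301.12420 — 6 statements merged into one kernel-verified Lean document; each statement's English description precedes it below -/
import Mathlib

section
/- Let (Ω,F,P) be a non-atomic probability space, G ⊆ F a sub-σ-algebra, u1, u2 ∈ U⁺_icx and α ∈ (0,1). Then for every X ∈ L∞(F), the set of minimizers argmin_{Z ∈ L∞(G)} π_α(X,Z) is nonempty. -/
open MeasureTheory Set Filter Topology

variable {Ω : Type*}

/-- `Z ∈ L∞(𝒢)`: `Z` is `𝒢`-measurable and bounded. -/
def BddMeas (𝒢 : MeasurableSpace Ω) (Z : Ω → ℝ) : Prop :=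
  Measurable[𝒢] Z ∧ ∃ C : ℝ, ∀ ω, |Z ω| ≤ C

/-- `u ∈ U⁺_icx`: `u` is strictly increasing and convex on `[0,∞)` with `u 0 = 0`, `u 1 = 1`. -/
def Uicx (u : ℝ → ℝ) : Prop :=
  StrictMonoOn u (Set.Ici 0) ∧ ConvexOn ℝ (Set.Ici 0) u ∧ u 0 = 0 ∧ u 1 = 1

/-- `π_α(X,Z) = α·E[u1((X−Z)⁺)] + (1−α)·E[u2((X−Z)⁻)]`. -/
noncomputable def piRisk {mΩ : MeasurableSpace Ω} (P : Measure Ω) (u1 u2 : ℝ → ℝ) (α : ℝ)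
    (X Z : Ω → ℝ) : ℝ :=
  α * ∫ ω, u1 (max (X ω - Z ω) 0) ∂P + (1 - α) * ∫ ω, u2 (max (Z ω - X ω) 0) ∂P

/-- The set of minimizers of `Z ↦ π_α(X,Z)` over `L∞(𝒢)`. -/
def ArgminSet {mΩ : MeasurableSpace Ω} (P : Measure Ω) (𝒢 : MeasurableSpace Ω)
    (u1 u2 : ℝ → ℝ) (α : ℝ) (X : Ω → ℝ) : Set (Ω → ℝ) :=
  {Z | BddMeas 𝒢 Z ∧ ∀ W, BddMeas 𝒢 W → piRisk P u1 u2 α X Z ≤ piRisk P u1 u2 α X W}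

/-- `ρ` is an essential infimum of the family `S` of random variables in the a.s. order. -/
def IsEssInf {mΩ : MeasurableSpace Ω} (P : Measure Ω) (S : Set (Ω → ℝ)) (ρ : Ω → ℝ) : Prop :=
  (∀ Z ∈ S, ρ ≤ᵐ[P] Z) ∧ ∀ W : Ω → ℝ, (∀ Z ∈ S, W ≤ᵐ[P] Z) → W ≤ᵐ[P] ρ

/-- The probability space is non-atomic. -/
def Nonatomic {mΩ : MeasurableSpace Ω} (P : Measure Ω) : Prop :=
  ∀ A : Set Ω, MeasurableSet[mΩ] A → 0 < P A →
    ∃ B ⊆ A, MeasurableSet[mΩ] B ∧ 0 < P B ∧ P B < P A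

/-- The acceptance set of the conditional shortfall risk measure:
`{Z ∈ L∞(𝒢) : E[v(X−Z)|𝒢] ≤ 0 a.s.}`. -/
def ShortfallSet {mΩ : MeasurableSpace Ω} (P : Measure Ω) (𝒢 : MeasurableSpace Ω)
    (v : ℝ → ℝ) (X : Ω → ℝ) : Set (Ω → ℝ) :=
  {Z | BddMeas 𝒢 Z ∧ ∀ᵐ ω ∂P, (P[fun ω' => v (X ω' - Z ω')|𝒢]) ω ≤ 0}

/-- Left derivative of `u` at `x`, multiplied by the indicator of `{x > 0}`. -/
noncomputable def ldInd (u : ℝ → ℝ) (x : ℝ) : ℝ :=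
  if 0 < x then derivWithin u (Set.Iic x) x else 0

/-- Right derivative of `u` at `x`, multiplied by the indicator of `{x ≥ 0}`. -/
noncomputable def rdInd (u : ℝ → ℝ) (x : ℝ) : ℝ :=
  if 0 ≤ x then derivWithin u (Set.Ici x) x else 0

/-- The function `v` built from `u1, u2, α`: `v(x) = α·(u1)'_−(x)` for `x > 0` and
`v(x) = −(1−α)·(u2)'_+(−x)` for `x ≤ 0`. -/
noncomputable def vFun (u1 u2 : ℝ → ℝ) (α : ℝ) (x : ℝ) : ℝ :=
  if 0 < x then α * derivWithin u1 (Set.Iic x) x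
  else -((1 - α) * derivWithin u2 (Set.Ici (-x)) (-x))

/-- `ρ` is a conditional convex risk measure: monotone, conditionally translation
invariant, conditionally convex and normalized. -/
def IsCondConvexRM {mΩ : MeasurableSpace Ω} (P : Measure Ω) (𝒢 : MeasurableSpace Ω)
    (ρ : (Ω → ℝ) → (Ω → ℝ)) : Prop :=
  (∀ X Y : Ω → ℝ, BddMeas mΩ X → BddMeas mΩ Y → X ≤ᵐ[P] Y → ρ X ≤ᵐ[P] ρ Y) ∧
  (∀ X Z : Ω → ℝ, BddMeas mΩ X → BddMeas 𝒢 Z →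
      ρ (fun ω => X ω + Z ω) =ᵐ[P] fun ω => ρ X ω + Z ω) ∧
  (∀ X Y Λ : Ω → ℝ, BddMeas mΩ X → BddMeas mΩ Y → BddMeas 𝒢 Λ →
      (∀ᵐ ω ∂P, 0 ≤ Λ ω ∧ Λ ω ≤ 1) →
      ρ (fun ω => Λ ω * X ω + (1 - Λ ω) * Y ω) ≤ᵐ[P]
        fun ω => Λ ω * ρ X ω + (1 - Λ ω) * ρ Y ω) ∧
  (ρ (fun _ => 0) =ᵐ[P] fun _ => 0)

/-- `ρ` is a conditional coherent risk measure: a conditional convex risk measure that is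
conditionally positively homogeneous. -/
def IsCondCoherentRM {mΩ : MeasurableSpace Ω} (P : Measure Ω) (𝒢 : MeasurableSpace Ω)
    (ρ : (Ω → ℝ) → (Ω → ℝ)) : Prop :=
  IsCondConvexRM P 𝒢 ρ ∧
  ∀ X Λ : Ω → ℝ, BddMeas mΩ X → BddMeas 𝒢 Λ → (∀ᵐ ω ∂P, 0 ≤ Λ ω) →
    ρ (fun ω => Λ ω * X ω) =ᵐ[P] fun ω => Λ ω * ρ X ω

/-- `𝒢` is generated by a finite measurable partition of `Ω`, each cell having positive
probability. -/
def FinitePartitionGen {mΩ : MeasurableSpace Ω} (P : Measure Ω)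
    (𝒢 : MeasurableSpace Ω) : Prop :=
  ∃ (n : ℕ) (A : Fin n → Set Ω),
    (∀ i, MeasurableSet[mΩ] (A i)) ∧ (∀ i, 0 < P (A i)) ∧
    Pairwise (Function.onFun Disjoint A) ∧ (⋃ i, A i) = Set.univ ∧
    𝒢 = MeasurableSpace.generateFrom {s | ∃ i, s = A i}

/-- Abstract selection of an almost-minimizing, almost-Cauchy sequence. -/
lemma cgq_seq {T : Type*} (D : Set T) (hD : D.Nonempty) (J N : T → ℝ) (mid : T → T → T)
    (hJ : ∀ x ∈ D, 0 ≤ J x) (hN : ∀ x ∈ D, 0 ≤ N x) (M : ℝ) (hM : ∀ x ∈ D, N x ≤ M)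
    (hmid : ∀ x ∈ D, ∀ y ∈ D, mid x y ∈ D)
    (hJm : ∀ x ∈ D, ∀ y ∈ D, ∀ c, J x ≤ c → J y ≤ c → J (mid x y) ≤ c)
    (δ : ℕ → ℝ) (hδ : ∀ k, 0 < δ k) :
    ∃ (Y : ℕ → T) (s : ℝ), (∀ k, Y k ∈ D) ∧ (∀ x ∈ D, s ≤ J x) ∧
      (∀ k, J (Y k) ≤ s + 1 / ((k : ℝ) + 1)) ∧
      ∀ k n m, k ≤ n → k ≤ m → 2 * N (Y n) + 2 * N (Y m) - 4 * N (mid (Y n) (Y m)) < δ k := by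
  set s : ℝ := sInf (J '' D) with hs
  have hbJ : BddBelow (J '' D) := ⟨0, by rintro _ ⟨x, hx, rfl⟩; exact hJ x hx⟩
  have hsJ : ∀ x ∈ D, s ≤ J x := fun x hx => csInf_le hbJ ⟨x, hx, rfl⟩
  let K : ℕ → Set T := fun n => {x | x ∈ D ∧ J x ≤ s + 1 / ((n : ℝ) + 1)}
  have hKne : ∀ n, (K n).Nonempty := by
    intro n
    have : s < s + 1 / ((n : ℝ) + 1) := by
      have : 0 < 1 / ((n : ℝ) + 1) := by positivity
      linarith
    obtain ⟨_, ⟨x, hx, rfl⟩, hlt⟩ := exists_lt_of_csInf_lt (hD.image J) this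
    exact ⟨x, hx, hlt.le⟩
  have hKanti : ∀ n m, n ≤ m → K m ⊆ K n := by
    intro n m hnm x hx
    refine ⟨hx.1, hx.2.trans ?_⟩
    have : 1 / ((m : ℝ) + 1) ≤ 1 / ((n : ℝ) + 1) := by gcongr
    linarith
  let a : ℕ → ℝ := fun n => sInf (N '' K n)
  have hbN : ∀ n, BddBelow (N '' K n) := fun n =>
    ⟨0, by rintro _ ⟨x, hx, rfl⟩; exact hN x hx.1⟩
  have haN : ∀ n, ∀ x ∈ K n, a n ≤ N x := fun n x hx => csInf_le (hbN n) ⟨x, hx, rfl⟩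
  have hamono : Monotone a := by
    intro n m hnm
    exact csInf_le_csInf (hbN n) ((hKne m).image N) (image_mono (hKanti n m hnm))
  have haM : BddAbove (range a) := by
    refine ⟨M, ?_⟩
    rintro _ ⟨n, rfl⟩
    obtain ⟨x, hx⟩ := hKne n
    exact (haN n x hx).trans (hM x hx.1)
  set A := ⨆ n, a n with hA
  have hlim : Tendsto a atTop (𝓝 A) := tendsto_atTop_ciSup hamono haM
  have haA : ∀ n, a n ≤ A := fun n => le_ciSup haM n
  have hex : ∀ n : ℕ, ∃ x ∈ K n, N x < a n + 1 / ((n : ℝ) + 1) := by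
    intro n
    have : a n < a n + 1 / ((n : ℝ) + 1) := by
      have : 0 < 1 / ((n : ℝ) + 1) := by positivity
      linarith
    obtain ⟨_, ⟨x, hx, rfl⟩, hlt⟩ := exists_lt_of_csInf_lt ((hKne n).image N) this
    exact ⟨x, hx, hlt⟩
  choose Z hZK hZN using hex
  have hb : Tendsto (fun n : ℕ => 4 * (A + 1 / ((n : ℝ) + 1)) - 4 * a n) atTop (𝓝 0) := by
    have h1 := tendsto_one_div_add_atTop_nhds_zero_nat (𝕜 := ℝ)
    have := ((h1.const_add A).const_mul 4).sub (hlim.const_mul 4)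
    simpa using this
  obtain ⟨φ, hφ, hφδ⟩ := extraction_forall_of_eventually'
    (P := fun k n => 4 * (A + 1 / ((n : ℝ) + 1)) - 4 * a n < δ k)
    (fun k => by
      have := hb.eventually (gt_mem_nhds (hδ k))
      exact eventually_atTop.1 this)
  refine ⟨fun k => Z (φ k), s, fun k => (hZK _).1, hsJ,
    fun k => (hKanti k (φ k) (hφ.id_le k) (hZK _)).2, ?_⟩
  intro k n m hn hm
  have hZle : ∀ n, k ≤ n → Z (φ n) ∈ K (φ k) ∧ N (Z (φ n)) ≤ A + 1 / ((φ k : ℝ) + 1) := by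
    intro n hn
    have hle : φ k ≤ φ n := hφ.monotone hn
    refine ⟨hKanti _ _ hle (hZK _), ?_⟩
    have h1 := hZN (φ n)
    have h2 := haA (φ n)
    have : 1 / ((φ n : ℝ) + 1) ≤ 1 / ((φ k : ℝ) + 1) := by gcongr
    linarith
  obtain ⟨hn1, hn2⟩ := hZle n hn
  obtain ⟨hm1, hm2⟩ := hZle m hm
  have hmK : mid (Z (φ n)) (Z (φ m)) ∈ K (φ k) :=
    ⟨hmid _ hn1.1 _ hm1.1, hJm _ hn1.1 _ hm1.1 _ hn1.2 hm1.2⟩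
  have h3 := haN _ _ hmK
  have h4 := hφδ k
  simp only at h4 ⊢
  linarith

lemma cgq_core (𝒢 : MeasurableSpace Ω) {mΩ : MeasurableSpace Ω} (P : Measure Ω)
    [IsProbabilityMeasure P] (hG : 𝒢 ≤ mΩ) (f : ℝ → ℝ) (hf : ConvexOn ℝ univ f)
    (hf0 : ∀ x, 0 ≤ f x) (X : Ω → ℝ) (hXm : Measurable X) (C : ℝ) (hXC : ∀ ω, |X ω| ≤ C) :
    ∃ Z : Ω → ℝ, Measurable[𝒢] Z ∧ (∀ ω, |Z ω| ≤ C) ∧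
      ∀ W : Ω → ℝ, Measurable[𝒢] W → (∀ ω, |W ω| ≤ C) →
        ∫ ω, f (X ω - Z ω) ∂P ≤ ∫ ω, f (X ω - W ω) ∂P := by
  have hfc : Continuous f := hf.locallyLipschitz.continuous
  obtain ⟨B, hB⟩ : ∃ B, ∀ x ∈ Icc (-(2 * C)) (2 * C), ‖f x‖ ≤ B :=
    isCompact_Icc.exists_bound_of_continuousOn hfc.continuousOn
  let D : Set (Ω → ℝ) := {Z | Measurable[𝒢] Z ∧ ∀ ω, |Z ω| ≤ C}
  have hDm : ∀ Z ∈ D, Measurable Z := fun Z hZ => hZ.1.mono hG le_rfl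
  have hfm : ∀ Z ∈ D, AEStronglyMeasurable (fun ω => f (X ω - Z ω)) P := fun Z hZ =>
    (hfc.measurable.comp (hXm.sub (hDm Z hZ))).aestronglyMeasurable
  have hfB : ∀ Z ∈ D, ∀ ω, ‖f (X ω - Z ω)‖ ≤ B := by
    intro Z hZ ω
    apply hB
    have h1 := abs_le.1 (hXC ω)
    have h2 := abs_le.1 (hZ.2 ω)
    constructor <;> linarith [h1.1, h1.2, h2.1, h2.2]
  have hfi : ∀ Z ∈ D, Integrable (fun ω => f (X ω - Z ω)) P := fun Z hZ =>
    Integrable.of_bound (hfm Z hZ) B (ae_of_all _ (hfB Z hZ))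
  have hsq : ∀ Z ∈ D, ∀ ω, Z ω ^ 2 ≤ C ^ 2 := fun Z hZ ω =>
    sq_le_sq' (abs_le.1 (hZ.2 ω)).1 (abs_le.1 (hZ.2 ω)).2
  have hNi : ∀ Z ∈ D, Integrable (fun ω => Z ω ^ 2) P := fun Z hZ =>
    Integrable.of_bound ((hDm Z hZ).pow_const 2).aestronglyMeasurable (C ^ 2)
      (ae_of_all _ fun ω => by
        rw [Real.norm_of_nonneg (sq_nonneg _)]; exact hsq Z hZ ω)
  have hmidD : ∀ Z ∈ D, ∀ W ∈ D, (fun ω => (1 / 2 : ℝ) * Z ω + (1 / 2) * W ω) ∈ D := by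
    intro Z hZ W hW
    refine ⟨(hZ.1.const_mul _).add (hW.1.const_mul _), fun ω => ?_⟩
    have h1 := abs_le.1 (hW.2 ω)
    have h2 := abs_le.1 (hZ.2 ω)
    rw [abs_le]
    constructor <;> linarith [h1.1, h1.2, h2.1, h2.2]
  obtain ⟨Y, s, hYD, hsJ, hYs, hYc⟩ := cgq_seq D
    ⟨fun _ => 0, measurable_const, fun ω => by
      simpa using (abs_nonneg _).trans (hXC ω)⟩
    (fun Z => ∫ ω, f (X ω - Z ω) ∂P) (fun Z => ∫ ω, Z ω ^ 2 ∂P)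
    (fun Z W ω => (1 / 2 : ℝ) * Z ω + (1 / 2) * W ω)
    (fun Z _ => integral_nonneg fun ω => hf0 _)
    (fun Z _ => integral_nonneg fun ω => sq_nonneg _) (C ^ 2)
    (fun Z hZ => by
      have := integral_mono (hNi Z hZ) (integrable_const (C ^ 2)) (hsq Z hZ)
      simpa using this)
    hmidD
    (fun Z hZ W hW c hc1 hc2 => by
      have h := integral_mono (hfi _ (hmidD Z hZ W hW))
        (((hfi Z hZ).const_mul (1 / 2)).add ((hfi W hW).const_mul (1 / 2)))
        (fun ω => by
          have := hf.2 (mem_univ (X ω - Z ω)) (mem_univ (X ω - W ω))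
            (by norm_num : (0 : ℝ) ≤ 1 / 2) (by norm_num : (0 : ℝ) ≤ 1 / 2) (by norm_num)
          simp only [smul_eq_mul] at this
          refine le_trans (le_of_eq ?_) this
          congr 1; ring)
      simp only [Pi.add_apply] at h
      rw [integral_add ((hfi Z hZ).const_mul (1 / 2)) ((hfi W hW).const_mul (1 / 2)),
        integral_const_mul, integral_const_mul] at h
      linarith)
    (fun k => ((1 / 2 : ℝ) ^ k) ^ 2) (fun k => by positivity)
  have hae : ∀ᵐ ω ∂P, ∃ l, Tendsto (fun n => Y n ω) atTop (𝓝 l) := by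
    refine Lp.ae_tendsto_of_cauchy_eLpNorm (p := 2)
      (fun n => (hDm _ (hYD n)).aestronglyMeasurable) (by norm_num)
      (B := fun k => ENNReal.ofReal ((1 / 2 : ℝ) ^ k)) ?_ ?_
    · rw [← ENNReal.ofReal_tsum_of_nonneg (fun k => by positivity) summable_geometric_two]
      exact ENNReal.ofReal_ne_top
    · intro k n m hn hm
      have hmem : MemLp (Y n - Y m) 2 P := by
        refine MemLp.of_bound ((hDm _ (hYD n)).sub (hDm _ (hYD m))).aestronglyMeasurable (2 * C)
          (ae_of_all _ fun ω => ?_)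
        have h1 := abs_le.1 ((hYD n).2 ω)
        have h2 := abs_le.1 ((hYD m).2 ω)
        rw [Real.norm_eq_abs, abs_le, Pi.sub_apply]
        constructor <;> linarith [h1.1, h1.2, h2.1, h2.2]
      rw [hmem.eLpNorm_eq_integral_rpow_norm (by norm_num) (by norm_num)]
      rw [ENNReal.ofReal_lt_ofReal_iff (by positivity)]
      have hc := hYc k n m hn hm
      have heq : ∫ ω, ‖(Y n - Y m) ω‖ ^ (2 : ENNReal).toReal ∂P
          = 2 * ∫ ω, Y n ω ^ 2 ∂P + 2 * ∫ ω, Y m ω ^ 2 ∂P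
            - 4 * ∫ ω, ((1 / 2 : ℝ) * Y n ω + (1 / 2) * Y m ω) ^ 2 ∂P := by
        have i1 := (hNi _ (hYD n)).const_mul 2
        have i2 := (hNi _ (hYD m)).const_mul 2
        have i3 := (hNi _ (hmidD _ (hYD n) _ (hYD m))).const_mul 4
        rw [← integral_const_mul, ← integral_const_mul, ← integral_const_mul,
          ← integral_add i1 i2]
        refine Eq.trans ?_ (integral_sub (i1.add i2) i3)
        refine integral_congr_ae (ae_of_all _ fun ω => ?_)
        simp only [ENNReal.toReal_ofNat, Real.rpow_ofNat, Real.norm_eq_abs, sq_abs, Pi.sub_apply,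
          Pi.add_apply]
        ring
      rw [heq]
      rw [show ((2 : ENNReal).toReal)⁻¹ = 1 / 2 by simp, ← Real.sqrt_eq_rpow]
      exact (Real.sqrt_lt' (by positivity)).2 hc
  let Z : Ω → ℝ := fun ω => max (-C) (min C (liminf (fun n => Y n ω) atTop))
  have hZm : Measurable[𝒢] Z :=
    measurable_const.max (measurable_const.min
      (Measurable.liminf (mδ := 𝒢) fun n => (hYD n).1))
  have hZD : Z ∈ D := by
    refine ⟨hZm, fun ω => ?_⟩
    have hC : 0 ≤ C := (abs_nonneg _).trans (hXC ω)
    exact abs_le.2 ⟨le_max_left _ _, max_le (by linarith) (min_le_left _ _)⟩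
  have hlim : ∀ᵐ ω ∂P, Tendsto (fun n => Y n ω) atTop (𝓝 (Z ω)) := by
    filter_upwards [hae] with ω ⟨l, hl⟩
    have hl1 : l ≤ C := le_of_tendsto' hl fun n => (abs_le.1 ((hYD n).2 ω)).2
    have hl2 : -C ≤ l := ge_of_tendsto' hl fun n => (abs_le.1 ((hYD n).2 ω)).1
    have : Z ω = l := by
      simp only [Z]
      rw [hl.liminf_eq, min_eq_right hl1, max_eq_right hl2]
    rw [this]; exact hl
  have hJlim : Tendsto (fun n => ∫ ω, f (X ω - Y n ω) ∂P) atTop (𝓝 (∫ ω, f (X ω - Z ω) ∂P)) := by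
    refine tendsto_integral_of_dominated_convergence (fun _ => B) (fun n => hfm _ (hYD n))
      (integrable_const _) (fun n => ae_of_all _ (hfB _ (hYD n))) ?_
    filter_upwards [hlim] with ω hω
    exact (hfc.tendsto _).comp (hω.const_sub (X ω))
  have hZs : ∫ ω, f (X ω - Z ω) ∂P ≤ s := by
    have h1 := (tendsto_one_div_add_atTop_nhds_zero_nat (𝕜 := ℝ)).const_add s
    rw [add_zero] at h1
    exact le_of_tendsto_of_tendsto' hJlim h1 hYs
  exact ⟨Z, hZD.1, hZD.2, fun W hW1 hW2 => hZs.trans (hsJ W ⟨hW1, hW2⟩)⟩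

lemma cgq_convex {u : ℝ → ℝ} (h : Uicx u) : ConvexOn ℝ univ (fun x => u (max x 0)) := by
  have hsub : (fun x : ℝ => max x 0) '' univ ⊆ Ici 0 := by
    rintro _ ⟨x, -, rfl⟩; exact le_max_right x (0 : ℝ)
  have himg : (fun x : ℝ => max x 0) '' univ = Ici 0 := by
    refine hsub.antisymm fun x hx => ⟨x, mem_univ _, max_eq_left hx⟩
  have hm : ConvexOn ℝ univ (fun x : ℝ => max x 0) :=
    (convexOn_id convex_univ).sup (convexOn_const 0 convex_univ)
  exact ConvexOn.comp (g := u) (by rw [himg]; exact h.2.1) hm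
    (by rw [himg]; exact h.1.monotoneOn)

lemma cgq_nonneg {u : ℝ → ℝ} (h : Uicx u) (x : ℝ) : 0 ≤ u (max x 0) := by
  have := h.1.monotoneOn (mem_Ici.2 le_rfl) (mem_Ici.2 (le_max_right x 0)) (le_max_right x 0)
  rwa [h.2.2.1] at this

lemma cgq_mono {u : ℝ → ℝ} (h : Uicx u) {x y : ℝ} (hxy : max x 0 ≤ max y 0) :
    u (max x 0) ≤ u (max y 0) :=
  h.1.monotoneOn (mem_Ici.2 (le_max_right _ _)) (mem_Ici.2 (le_max_right _ _)) hxy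

lemma cgq_int {mΩ : MeasurableSpace Ω} (P : Measure Ω) [IsProbabilityMeasure P]
    {u : ℝ → ℝ} (h : Uicx u) (V : Ω → ℝ) (hV : BddMeas mΩ V) :
    Integrable (fun ω => u (max (V ω) 0)) P := by
  obtain ⟨hm, C, hC⟩ := hV
  have hc : Continuous (fun x => u (max x 0)) := (cgq_convex h).locallyLipschitz.continuous
  refine Integrable.of_bound (hc.measurable.comp hm).aestronglyMeasurable (u (max C 0))
    (ae_of_all _ fun ω => ?_)
  rw [Real.norm_of_nonneg (cgq_nonneg h _)]
  exact cgq_mono h (max_le_max (abs_le.1 (hC ω)).2 le_rfl)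

lemma cgq_sub {mΩ : MeasurableSpace Ω} {V W : Ω → ℝ} (hV : BddMeas mΩ V) (hW : BddMeas mΩ W) :
    BddMeas mΩ (fun ω => V ω - W ω) := by
  obtain ⟨hm, C, hC⟩ := hV
  obtain ⟨hm', C', hC'⟩ := hW
  refine ⟨hm.sub hm', C + C', fun ω => ?_⟩
  exact (abs_sub _ _).trans (add_le_add (hC ω) (hC' ω))

/-- Theorem 3.1 (i): the set of minimizers of `Z ↦ π_α(X,Z)` over
`L∞(𝒢)` is nonempty. -/
theorem conditional_generalized_quantile_argmin_nonempty
    [mΩ : MeasurableSpace Ω] (P : Measure Ω) [IsProbabilityMeasure P]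
    (hP : Nonatomic P) (𝒢 : MeasurableSpace Ω) (hG : 𝒢 ≤ mΩ)
    {u1 u2 : ℝ → ℝ} (h1 : Uicx u1) (h2 : Uicx u2)
    {α : ℝ} (hα : α ∈ Set.Ioo (0:ℝ) 1)
    (X : Ω → ℝ) (hX : BddMeas mΩ X) :
    (ArgminSet P 𝒢 u1 u2 α X).Nonempty := by
  obtain ⟨hXm, C, hXC⟩ := hX
  have hα0 : 0 ≤ α := hα.1.le
  have hα1 : 0 ≤ 1 - α := by linarith [hα.2]
  let f : ℝ → ℝ := fun x => α * u1 (max x 0) + (1 - α) * u2 (max (-x) 0)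
  have hf : ConvexOn ℝ univ f := by
    have c1 := (cgq_convex h1).smul hα0
    have c2 := ((cgq_convex h2).comp_linearMap (-LinearMap.id)).smul hα1
    exact c1.add c2
  have hf0 : ∀ x, 0 ≤ f x := fun x =>
    add_nonneg (mul_nonneg hα0 (cgq_nonneg h1 _)) (mul_nonneg hα1 (cgq_nonneg h2 _))
  have hmono : ∀ W, BddMeas 𝒢 W → BddMeas mΩ W := fun W hW => ⟨hW.1.mono hG le_rfl, hW.2⟩
  have hpi : ∀ W, BddMeas 𝒢 W → piRisk P u1 u2 α X W = ∫ ω, f (X ω - W ω) ∂P := by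
    intro W hW
    have i1 := (cgq_int P h1 _ (cgq_sub ⟨hXm, C, hXC⟩ (hmono W hW))).const_mul α
    have i2 := (cgq_int P h2 _ (cgq_sub (hmono W hW) ⟨hXm, C, hXC⟩)).const_mul (1 - α)
    simp only [piRisk, f, neg_sub]
    rw [integral_add i1 i2, integral_const_mul, integral_const_mul]
  obtain ⟨Z, hZm, hZC, hZ⟩ := cgq_core 𝒢 P hG f hf hf0 X hXm C hXC
  refine ⟨Z, ⟨hZm, C, hZC⟩, fun W hW => ?_⟩
  let V : Ω → ℝ := fun ω => max (-C) (min C (W ω))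
  have hVm : Measurable[𝒢] V := measurable_const.max (measurable_const.min hW.1)
  have hVC : ∀ ω, |V ω| ≤ C := fun ω => by
    have hC : 0 ≤ C := (abs_nonneg _).trans (hXC ω)
    exact abs_le.2 ⟨le_max_left _ _, max_le (by linarith) (min_le_left _ _)⟩
  have hVb : BddMeas 𝒢 V := ⟨hVm, C, hVC⟩
  rw [hpi Z ⟨hZm, C, hZC⟩]
  refine (hZ V hVm hVC).trans ?_
  rw [← hpi V hVb]
  have hX' : BddMeas mΩ X := ⟨hXm, C, hXC⟩
  have key : ∀ ω, max (X ω - V ω) 0 ≤ max (X ω - W ω) 0 ∧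
      max (V ω - X ω) 0 ≤ max (W ω - X ω) 0 := by
    intro ω
    have hx := abs_le.1 (hXC ω)
    simp only [V]
    constructor <;> grind
  refine add_le_add (mul_le_mul_of_nonneg_left ?_ hα0) (mul_le_mul_of_nonneg_left ?_ hα1)
  · exact integral_mono (cgq_int P h1 _ (cgq_sub hX' (hmono V hVb)))
      (cgq_int P h1 _ (cgq_sub hX' (hmono W hW))) fun ω => cgq_mono h1 (key ω).1
  · exact integral_mono (cgq_int P h2 _ (cgq_sub (hmono V hVb) hX'))
      (cgq_int P h2 _ (cgq_sub (hmono W hW) hX')) fun ω => cgq_mono h2 (key ω).2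
end

section
/- Let (Ω,F,P) be a non-atomic probability space, G ⊆ F a sub-σ-algebra, u1, u2 ∈ U⁺_icx, α ∈ (0,1) and X ∈ L∞(F). If Z1 and Z2 both belong to argmin_{Z ∈ L∞(G)} π_α(X,Z), then E[φ_α(X,Z1) | G] = E[φ_α(X,Z2) | G] P-a.s., where φ_α(X,Z) = α·u1((X−Z)⁺) + (1−α)·u2((X−Z)⁻). -/
open MeasureTheory Set Filter Topology

variable {Ω : Type*}

theorem aux_int {mΩ : MeasurableSpace Ω} (P : Measure Ω) [IsProbabilityMeasure P]
    {u : ℝ → ℝ} (h : Uicx u) {Y : Ω → ℝ} (hY : Measurable Y) {C : ℝ} (hC : ∀ ω, Y ω ≤ C) :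
    Integrable (fun ω => u (max (Y ω) 0)) P := by
  have hm : Monotone (fun x : ℝ => u (max x 0)) := by
    intro x y hxy
    exact h.1.monotoneOn (by simp) (by simp) (max_le_max hxy le_rfl)
  refine Integrable.of_bound (C := u (max C 0)) (hm.measurable.comp hY).aestronglyMeasurable ?_
  refine Eventually.of_forall fun ω => ?_
  have h0 : 0 ≤ u (max (Y ω) 0) := by
    have := h.1.monotoneOn (a := 0) (b := max (Y ω) 0) (by simp) (by simp) (by simp)
    rwa [h.2.2.1] at this
  rw [Real.norm_of_nonneg h0]
  exact hm (hC ω)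

theorem aux_int2 {mΩ : MeasurableSpace Ω} (P : Measure Ω) [IsProbabilityMeasure P]
    {u1 u2 : ℝ → ℝ} (h1 : Uicx u1) (h2 : Uicx u2) {X Z : Ω → ℝ}
    (hX : BddMeas mΩ X) (hZ : BddMeas mΩ Z) :
    Integrable (fun ω => u1 (max (X ω - Z ω) 0)) P ∧
    Integrable (fun ω => u2 (max (Z ω - X ω) 0)) P := by
  obtain ⟨hXm, C, hC⟩ := hX
  obtain ⟨hZm, D, hD⟩ := hZ
  refine ⟨aux_int P h1 (hXm.sub hZm) (C := C + D) fun ω => ?_,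
    aux_int P h2 (hZm.sub hXm) (C := C + D) fun ω => ?_⟩
  all_goals
    have := abs_le.1 (hC ω)
    have := abs_le.1 (hD ω)
    linarith

theorem aux_risk {mΩ : MeasurableSpace Ω} (P : Measure Ω) [IsProbabilityMeasure P]
    {u1 u2 : ℝ → ℝ} (h1 : Uicx u1) (h2 : Uicx u2) (α : ℝ) {X Z : Ω → ℝ}
    (hX : BddMeas mΩ X) (hZ : BddMeas mΩ Z) :
    Integrable (fun ω => α * u1 (max (X ω - Z ω) 0) + (1 - α) * u2 (max (Z ω - X ω) 0)) P ∧
    piRisk P u1 u2 α X Z =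
      ∫ ω, (α * u1 (max (X ω - Z ω) 0) + (1 - α) * u2 (max (Z ω - X ω) 0)) ∂P := by
  obtain ⟨i1, i2⟩ := aux_int2 P h1 h2 hX hZ
  refine ⟨(i1.const_mul α).add (i2.const_mul (1 - α)), ?_⟩
  rw [integral_add (i1.const_mul α) (i2.const_mul (1 - α)), integral_const_mul,
    integral_const_mul, piRisk]

theorem aux_le {mΩ : MeasurableSpace Ω} (P : Measure Ω) [IsProbabilityMeasure P]
    (𝒢 : MeasurableSpace Ω) (hG : 𝒢 ≤ mΩ)
    {u1 u2 : ℝ → ℝ} (h1 : Uicx u1) (h2 : Uicx u2) {α : ℝ}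
    {X Z1 Z2 : Ω → ℝ} (hX : BddMeas mΩ X)
    (hZ1 : Z1 ∈ ArgminSet P 𝒢 u1 u2 α X) (hZ2 : BddMeas 𝒢 Z2)
    {A : Set Ω} (hA : MeasurableSet[𝒢] A) :
    ∫ ω in A, (α * u1 (max (X ω - Z1 ω) 0) + (1 - α) * u2 (max (Z1 ω - X ω) 0)) ∂P ≤
    ∫ ω in A, (α * u1 (max (X ω - Z2 ω) 0) + (1 - α) * u2 (max (Z2 ω - X ω) 0)) ∂P := by
  classical
  obtain ⟨hZ1, hmin⟩ := hZ1
  have up : ∀ {Z : Ω → ℝ}, BddMeas 𝒢 Z → BddMeas mΩ Z := fun h => ⟨h.1.mono hG le_rfl, h.2⟩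
  have hW : BddMeas 𝒢 (A.piecewise Z2 Z1) := by
    obtain ⟨m1, C, hC⟩ := hZ1
    obtain ⟨m2, D, hD⟩ := hZ2
    refine ⟨Measurable.piecewise hA m2 m1, max C D, fun ω => ?_⟩
    by_cases hω : ω ∈ A
    · simpa [hω] using Or.inr (hD ω)
    · simpa [hω] using Or.inl (hC ω)
  have key := hmin _ hW
  obtain ⟨i1, r1⟩ := aux_risk P h1 h2 α hX (up hZ1)
  obtain ⟨i2, r2⟩ := aux_risk P h1 h2 α hX (up hZ2)
  obtain ⟨iW, rW⟩ := aux_risk P h1 h2 α hX (up hW)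
  have hA' := hG _ hA
  rw [r1, rW, ← integral_add_compl hA' i1, ← integral_add_compl hA' iW] at key
  rw [setIntegral_congr_fun (s := A)
      (f := fun ω => α * u1 (max (X ω - A.piecewise Z2 Z1 ω) 0) +
      (1 - α) * u2 (max (A.piecewise Z2 Z1 ω - X ω) 0)) (g := fun ω => α * u1 (max (X ω - Z2 ω) 0) +
      (1 - α) * u2 (max (Z2 ω - X ω) 0)) hA' (fun ω hω => by simp [hω]),
    setIntegral_congr_fun (s := Aᶜ) (f := fun ω => α * u1 (max (X ω - A.piecewise Z2 Z1 ω) 0) +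
      (1 - α) * u2 (max (A.piecewise Z2 Z1 ω - X ω) 0))
      (g := fun ω => α * u1 (max (X ω - Z1 ω) 0) +
      (1 - α) * u2 (max (Z1 ω - X ω) 0)) hA'.compl
      (fun ω hω => by simp [(show ω ∉ A from hω)])] at key
  linarith

/-- Theorem 3.1 (ii): any two minimizers `Z1, Z2` of `Z ↦ π_α(X,Z)` over
`L∞(𝒢)` satisfy `E[φ_α(X,Z1)|𝒢] = E[φ_α(X,Z2)|𝒢]` a.s. -/
theorem conditional_generalized_quantile_condexp_eq_of_argmin
    [mΩ : MeasurableSpace Ω] (P : Measure Ω) [IsProbabilityMeasure P]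
    (hP : Nonatomic P) (𝒢 : MeasurableSpace Ω) (hG : 𝒢 ≤ mΩ)
    {u1 u2 : ℝ → ℝ} (h1 : Uicx u1) (h2 : Uicx u2)
    {α : ℝ} (hα : α ∈ Set.Ioo (0:ℝ) 1)
    (X : Ω → ℝ) (hX : BddMeas mΩ X)
    (Z1 Z2 : Ω → ℝ)
    (hZ1 : Z1 ∈ ArgminSet P 𝒢 u1 u2 α X)
    (hZ2 : Z2 ∈ ArgminSet P 𝒢 u1 u2 α X) :
    P[fun ω => α * u1 (max (X ω - Z1 ω) 0) + (1 - α) * u2 (max (Z1 ω - X ω) 0)|𝒢]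
      =ᵐ[P]
    P[fun ω => α * u1 (max (X ω - Z2 ω) 0) + (1 - α) * u2 (max (Z2 ω - X ω) 0)|𝒢] := by
  have up : ∀ {Z : Ω → ℝ}, BddMeas 𝒢 Z → BddMeas mΩ Z := fun h => ⟨h.1.mono hG le_rfl, h.2⟩
  have i1 := (aux_risk P h1 h2 α hX (up hZ1.1)).1
  have i2 := (aux_risk P h1 h2 α hX (up hZ2.1)).1
  refine ae_eq_condExp_of_forall_setIntegral_eq hG i2
    (fun s _ _ => integrable_condExp.integrableOn) (fun s hs _ => ?_)
    stronglyMeasurable_condExp.aestronglyMeasurable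
  rw [setIntegral_condExp hG i1 hs]
  exact le_antisymm (aux_le P 𝒢 hG h1 h2 hX hZ1 hZ2.1 hs) (aux_le P 𝒢 hG h1 h2 hX hZ2 hZ1.1 hs)
end

section
/- Let (Ω,F,P) be a non-atomic probability space, G ⊆ F a sub-σ-algebra, u1, u2 ∈ U⁺_icx, α ∈ (0,1) and X ∈ L∞(F). Then the essential infimum of the set argmin_{Z ∈ L∞(G)} π_α(X,Z) is itself an element of argmin_{Z ∈ L∞(G)} π_α(X,Z); in particular this set is directed downward (closed under pointwise minimum of any two of its elements). -/
open MeasureTheory Set Filter Topology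

variable {Ω : Type*}

/-- Measurable selection of the smallest minimizer. -/
lemma smallest_minimizer {β : Type*} [MeasurableSpace β] (h : β → ℝ → ℝ) (C : ℝ) (hC : 0 ≤ C)
    (hcont : ∀ b, Continuous (h b)) (hmeas : ∀ z, Measurable (fun b => h b z))
    (hlow : ∀ b z, z < -C → h b (-C) < h b z) (hhigh : ∀ b z, C < z → h b C < h b z) :
    ∃ ρ : β → ℝ, Measurable ρ ∧ (∀ b, |ρ b| ≤ C) ∧ (∀ b z, h b (ρ b) ≤ h b z) ∧
      (∀ b z, h b z ≤ h b (ρ b) → ρ b ≤ z) := by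
  have key : ∀ b, ∃ r, |r| ≤ C ∧ (∀ z, h b r ≤ h b z) ∧ (∀ z, h b z ≤ h b r → r ≤ z) := by
    intro b
    obtain ⟨m, hm, hmin⟩ := (isCompact_Icc (a := -C) (b := C)).exists_isMinOn
      ⟨0, by constructor <;> linarith⟩ (hcont b).continuousOn
    have hmin' : ∀ z, h b m ≤ h b z := by
      intro z
      rcases lt_or_ge z (-C) with hz | hz
      · exact (hmin (show -C ∈ Icc (-C) C by constructor <;> linarith)).trans (hlow b z hz).le
      rcases lt_or_ge C z with hz' | hz'
      · exact (hmin (show C ∈ Icc (-C) C by constructor <;> linarith)).trans (hhigh b z hz').le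
      · exact hmin ⟨hz, hz'⟩
    have hA : IsCompact (Icc (-C) C ∩ {z | h b z ≤ h b m}) :=
      isCompact_Icc.inter_right (isClosed_le (hcont b) continuous_const)
    obtain ⟨r, hr, hrmin⟩ := hA.exists_isLeast ⟨m, hm, show h b m ≤ h b m from le_refl _⟩
    refine ⟨r, abs_le.2 hr.1, fun z => le_trans hr.2 (hmin' z), fun z hz => ?_⟩
    have hz' : h b z ≤ h b m := hz.trans hr.2
    apply hrmin
    refine ⟨⟨?_, ?_⟩, hz'⟩
    · by_contra hlt
      exact absurd (hmin' (-C)) (not_le.2 ((hlow b z (not_le.1 hlt)).trans_le hz'))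
    · by_contra hlt
      exact absurd (hmin' C) (not_le.2 ((hhigh b z (not_le.1 hlt)).trans_le hz'))
  choose ρ h1 h2 h3 using key
  refine ⟨ρ, ?_, h1, h2, h3⟩
  refine measurable_of_Iic fun q => ?_
  rcases lt_or_ge q (-C) with hq | hq
  · have : ρ ⁻¹' Iic q = ∅ := by
      ext b
      simp only [mem_preimage, mem_Iic, mem_empty_iff_false, iff_false, not_le]
      exact hq.trans_le (abs_le.1 (h1 b)).1
    rw [this]
    exact MeasurableSet.empty
  have : Nonempty (Icc (-C) q) := ⟨⟨-C, le_refl _, hq⟩⟩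
  have : ρ ⁻¹' Iic q = ⋂ n : ℕ, ⋂ k : ℕ, ⋃ j : ℕ,
      {b | h b (TopologicalSpace.denseSeq (Icc (-C) q) j : ℝ) <
        h b (TopologicalSpace.denseSeq ℝ k) + 1 / ((n : ℝ) + 1)} := by
    ext b
    simp only [mem_preimage, mem_Iic, mem_iInter, mem_iUnion, mem_ofPred_eq]
    constructor
    · intro hb n k
      have hpos : (0 : ℝ) < 1 / ((n : ℝ) + 1) := by positivity
      have hopen : IsOpen {z : Icc (-C) q | h b z <
          h b (TopologicalSpace.denseSeq ℝ k) + 1 / ((n : ℝ) + 1)} :=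
        isOpen_lt ((hcont b).comp continuous_subtype_val) continuous_const
      obtain ⟨z, hz, j, rfl⟩ :=
        (TopologicalSpace.denseRange_denseSeq (Icc (-C) q)).inter_open_nonempty _ hopen
        ⟨⟨ρ b, (abs_le.1 (h1 b)).1, hb⟩, by
          have := h2 b (TopologicalSpace.denseSeq ℝ k)
          simp only [mem_ofPred_eq]; linarith⟩
      exact ⟨j, hz⟩
    · intro hb
      obtain ⟨z0, hz0, hmin⟩ := (isCompact_Icc (a := -C) (b := q)).exists_isMinOn
        ⟨-C, le_refl _, hq⟩ (hcont b).continuousOn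
      have hk : ∀ k, h b z0 ≤ h b (TopologicalSpace.denseSeq ℝ k) := by
        intro k
        refine le_of_forall_pos_lt_add fun ε hε => ?_
        obtain ⟨n, hn⟩ := exists_nat_one_div_lt hε
        obtain ⟨j, hj⟩ := hb n k
        have := hmin (TopologicalSpace.denseSeq (Icc (-C) q) j).2
        simp only [mem_ofPred_eq] at this
        linarith
      have hall : ∀ w, h b z0 ≤ h b w := by
        intro w
        have hcl : IsClosed {w | h b z0 ≤ h b w} := isClosed_le continuous_const (hcont b)
        have := (TopologicalSpace.denseRange_denseSeq ℝ).induction_on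
          (p := fun w => h b z0 ≤ h b w) w hcl hk
        exact this
      exact (h3 b z0 (hall _)).trans hz0.2
  rw [this]
  refine MeasurableSet.iInter fun n => MeasurableSet.iInter fun k => MeasurableSet.iUnion fun j => ?_
  exact measurableSet_lt (hmeas _) ((hmeas _).add_const _)

lemma uicx_cont {u : ℝ → ℝ} (hu : Uicx u) : Continuous (fun t => u (max t 0)) := by
  have him : (fun t : ℝ => max t 0) '' univ = Ici 0 := by
    ext t
    simp only [image_univ, mem_range, mem_Ici]
    exact ⟨fun ⟨y, hy⟩ => hy ▸ le_max_right _ _, fun h => ⟨t, max_eq_left h⟩⟩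
  have hc : ConvexOn ℝ univ (fun t : ℝ => max t 0) :=
    (convexOn_id convex_univ).sup (convexOn_const 0 convex_univ)
  have := ConvexOn.comp (g := u) (f := fun t : ℝ => max t 0) (s := univ)
    (by rw [him]; exact hu.2.1) hc (by rw [him]; exact hu.1.monotoneOn)
  exact continuousOn_univ.1 (this.continuousOn isOpen_univ)

lemma key_rep {Ω β : Type*} [MeasurableSpace Ω] [MeasurableSpace β] (P : Measure Ω)
    [IsProbabilityMeasure P] (T : Ω → β) (hT : Measurable T) (X : Ω → ℝ) (hX : Measurable X)
    (L : ℝ → ℝ → ℝ) (hL : Continuous (Function.uncurry L)) (C : ℝ) (hC : 0 ≤ C)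
    (hB : ∀ R, ∃ M, ∀ x z, |z| ≤ R → |L x z| ≤ M)
    (hlow : ∀ x z, z < -C → L x (-C) < L x z) (hhigh : ∀ x z, C < z → L x C < L x z) :
    ∃ (h : β → ℝ → ℝ) (ρ : β → ℝ), Measurable ρ ∧ (∀ b, |ρ b| ≤ C) ∧
      (∀ b z, h b (ρ b) ≤ h b z) ∧ (∀ b z, h b z ≤ h b (ρ b) → ρ b ≤ z) ∧
      ∀ Z : β → ℝ, Measurable Z → (∃ R, ∀ b, |Z b| ≤ R) →
        Integrable (fun ω => h (T ω) (Z (T ω))) P ∧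
        ∫ ω, L (X ω) (Z (T ω)) ∂P = ∫ ω, h (T ω) (Z (T ω)) ∂P := by
  set κ := ProbabilityTheory.condDistrib X T P with hκ
  have hLz : ∀ z, Continuous (fun x => L x z) := fun z =>
    hL.comp (continuous_id.prodMk continuous_const)
  have hLx : ∀ x, Continuous (L x) := fun x =>
    hL.comp (continuous_const.prodMk continuous_id)
  have hint : ∀ b z, Integrable (fun x => L x z) (κ b) := by
    intro b z
    obtain ⟨M, hM⟩ := hB |z|
    exact Integrable.of_bound (hLz z).aestronglyMeasurable M
      (Eventually.of_forall fun x => hM x z le_rfl)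
  have hstrict : ∀ b z w, (∀ x, L x z < L x w) → ∫ x, L x z ∂(κ b) < ∫ x, L x w ∂(κ b) := by
    intro b z w hlt
    have hpos : 0 < ∫ x, (L x w - L x z) ∂(κ b) := by
      rw [integral_pos_iff_support_of_nonneg (fun x => (sub_pos.2 (hlt x)).le)
        ((hint b w).sub (hint b z))]
      have : Function.support (fun x => L x w - L x z) = univ := by
        ext x
        simpa using (sub_pos.2 (hlt x)).ne'
      rw [this]
      simp
    rw [integral_sub (hint b w) (hint b z)] at hpos
    linarith
  obtain ⟨ρ, hρ1, hρ2, hρ3, hρ4⟩ := smallest_minimizer (fun b z => ∫ x, L x z ∂(κ b)) C hC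
    (by
      intro b
      refine continuous_iff_continuousAt.2 fun z0 => ?_
      obtain ⟨M, hM⟩ := hB (|z0| + 1)
      refine continuousAt_of_dominated (bound := fun _ => M)
        (Eventually.of_forall fun z => (hLz z).aestronglyMeasurable) ?_ (integrable_const _)
        (Eventually.of_forall fun x => (hLx x).continuousAt)
      have : ∀ᶠ z in 𝓝 z0, |z| < |z0| + 1 :=
        continuous_abs.continuousAt.eventually_lt_const (by linarith)
      filter_upwards [this] with z hz
      exact Eventually.of_forall fun x => hM x z hz.le)
    (fun z => (StronglyMeasurable.integral_kernel (κ := κ)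
      (hLz z).stronglyMeasurable).measurable)
    (fun b z hz => hstrict b _ _ fun x => hlow x z hz)
    (fun b z hz => hstrict b _ _ fun x => hhigh x z hz)
  refine ⟨_, ρ, hρ1, hρ2, hρ3, hρ4, ?_⟩
  rintro Z hZ ⟨R, hR⟩
  obtain ⟨M, hM⟩ := hB R
  have hf : StronglyMeasurable (fun p : β × ℝ => L p.2 (Z p.1)) :=
    (hL.measurable.comp (measurable_snd.prodMk (hZ.comp measurable_fst))).stronglyMeasurable
  have hfi : Integrable (fun ω => L (X ω) (Z (T ω))) P :=
    Integrable.of_bound (hf.measurable.comp (hT.prodMk hX)).aestronglyMeasurable M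
      (Eventually.of_forall fun ω => hM _ _ (hR _))
  have hae := ProbabilityTheory.condExp_prod_ae_eq_integral_condDistrib (μ := P) (X := T) (Y := X)
    (f := fun p : β × ℝ => L p.2 (Z p.1)) hT hX.aemeasurable hf hfi
  refine ⟨(integrable_congr hae).1 integrable_condExp, ?_⟩
  rw [← integral_congr_ae hae, integral_condExp hT.comap_le]

/-- Theorem 3.1 (iii): the essential infimum of the set of minimizers of
`Z ↦ π_α(X,Z)` over `L∞(𝒢)` is itself a minimizer; in particular the set of minimizers is
directed downward (closed under pointwise minimum). -/
theorem conditional_generalized_quantile_essInf_mem_argmin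
    [mΩ : MeasurableSpace Ω] (P : Measure Ω) [IsProbabilityMeasure P]
    (hP : Nonatomic P) (𝒢 : MeasurableSpace Ω) (hG : 𝒢 ≤ mΩ)
    {u1 u2 : ℝ → ℝ} (h1 : Uicx u1) (h2 : Uicx u2)
    {α : ℝ} (hα : α ∈ Set.Ioo (0:ℝ) 1)
    (X : Ω → ℝ) (hX : BddMeas mΩ X) :
    (∃ ρ : Ω → ℝ, IsEssInf P (ArgminSet P 𝒢 u1 u2 α X) ρ ∧
        ρ ∈ ArgminSet P 𝒢 u1 u2 α X) ∧
    (∀ Z1 ∈ ArgminSet P 𝒢 u1 u2 α X, ∀ Z2 ∈ ArgminSet P 𝒢 u1 u2 α X,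
        (fun ω => min (Z1 ω) (Z2 ω)) ∈ ArgminSet P 𝒢 u1 u2 α X) := by
  classical
  obtain ⟨hXm, C0, hC0⟩ := hX
  obtain ⟨hα0, hα1⟩ := hα
  set C := max C0 0 with hCdef
  have hC : 0 ≤ C := le_max_right _ _
  have hXC : ∀ ω, |X ω| ≤ C := fun ω => (hC0 ω).trans (le_max_left _ _)
  have g1c := uicx_cont h1
  have g2c := uicx_cont h2
  let clip : ℝ → ℝ := fun x => max (-C) (min x C)
  have clipc : Continuous clip := by fun_prop
  have clip1 : ∀ x, -C ≤ clip x := fun x => le_max_left _ _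
  have clip2 : ∀ x, clip x ≤ C := fun x => max_le (by linarith) (min_le_right _ _)
  have clipX : ∀ ω, clip (X ω) = X ω := by
    intro ω
    have := abs_le.1 (hXC ω)
    simp only [clip]
    rw [min_eq_left this.2, max_eq_right this.1]
  let L : ℝ → ℝ → ℝ := fun x z => α * u1 (max (clip x - z) 0) + (1 - α) * u2 (max (z - clip x) 0)
  have hL : Continuous (Function.uncurry L) := by
    refine (continuous_const.mul (g1c.comp ?_)).add (continuous_const.mul (g2c.comp ?_))
    · exact (clipc.comp continuous_fst).sub continuous_snd
    · exact continuous_snd.sub (clipc.comp continuous_fst)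
  have hclipclip : ∀ x, clip (clip x) = clip x := by
    intro x
    show max (-C) (min (clip x) C) = clip x
    rw [min_eq_left (clip2 x), max_eq_right (clip1 x)]
  have hB : ∀ R, ∃ M, ∀ x z, |z| ≤ R → |L x z| ≤ M := by
    intro R
    obtain ⟨M, hM⟩ := ((isCompact_Icc (a := -C) (b := C)).prod
      (isCompact_Icc (a := -R) (b := R))).exists_bound_of_continuousOn hL.continuousOn
    refine ⟨M, fun x z hz => ?_⟩
    have := hM (clip x, z) ⟨⟨clip1 x, clip2 x⟩, abs_le.1 hz⟩
    simpa [Function.uncurry, L, hclipclip] using this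
  have hlow : ∀ x z, z < -C → L x (-C) < L x z := by
    intro x z hz
    have a1 := clip1 x
    have : u1 (max (clip x - -C) 0) < u1 (max (clip x - z) 0) := by
      apply h1.1 (le_max_right _ _ : (0:ℝ) ≤ _) (le_max_right _ _ : (0:ℝ) ≤ _)
      rw [max_eq_left (by linarith), max_eq_left (by linarith)]; linarith
    have e1 : max (-C - clip x) 0 = 0 := max_eq_right (by linarith)
    have e2 : max (z - clip x) 0 = 0 := max_eq_right (by linarith)
    simp only [L, e1, e2]
    have := mul_lt_mul_of_pos_left this hα0
    linarith
  have hhigh : ∀ x z, C < z → L x C < L x z := by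
    intro x z hz
    have a1 := clip2 x
    have : u2 (max (C - clip x) 0) < u2 (max (z - clip x) 0) := by
      apply h2.1 (le_max_right _ _ : (0:ℝ) ≤ _) (le_max_right _ _ : (0:ℝ) ≤ _)
      rw [max_eq_left (by linarith), max_eq_left (by linarith)]; linarith
    have e1 : max (clip x - C) 0 = 0 := max_eq_right (by linarith)
    have e2 : max (clip x - z) 0 = 0 := max_eq_right (by linarith)
    simp only [L, e1, e2]
    have := mul_lt_mul_of_pos_left this (sub_pos.2 hα1)
    linarith
  obtain ⟨h, ρ, hρm, hρC, hρmin, hρsm, hrep⟩ :=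
    @key_rep Ω Ω mΩ 𝒢 P _ (fun ω => ω) (fun s hs => hG s hs) X hXm L hL C hC hB hlow hhigh
  have hpi : ∀ Z, BddMeas 𝒢 Z → Integrable (fun ω => h ω (Z ω)) P ∧
      piRisk P u1 u2 α X Z = ∫ ω, h ω (Z ω) ∂P := by
    rintro Z ⟨hZ, R, hR⟩
    obtain ⟨hi, he⟩ := hrep Z hZ ⟨R, hR⟩
    refine ⟨hi, ?_⟩
    have hZ' : Measurable[mΩ] Z := hZ.mono hG le_rfl
    rw [← he]
    have hbd : ∀ {u : ℝ → ℝ} {Y : Ω → ℝ}, Continuous (fun t => u (max t 0)) → Measurable[mΩ] Y →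
        (∀ ω, |Y ω| ≤ C + R) → Integrable (fun ω => u (max (Y ω) 0)) P := by
      intro u Y hu hY hYb
      obtain ⟨M, hM⟩ := (isCompact_Icc (a := -(C + R)) (b := C + R)).exists_bound_of_continuousOn
        hu.continuousOn
      exact Integrable.of_bound (hu.measurable.comp hY).aestronglyMeasurable M
        (Eventually.of_forall fun ω => hM _ (abs_le.1 (hYb ω)))
    have i1 := hbd g1c (hXm.sub hZ') (fun ω => (abs_sub _ _).trans (add_le_add (hXC ω) (hR ω)))
    have i2 := hbd g2c (hZ'.sub hXm) (fun ω => by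
      have := (abs_sub (Z ω) (X ω)).trans (add_le_add (hR ω) (hXC ω))
      simp only [Pi.sub_apply]
      linarith)
    simp only [Pi.sub_apply] at i1 i2
    simp only [L, clipX]
    rw [integral_add (i1.const_mul _) (i2.const_mul _), integral_const_mul, integral_const_mul]
    rfl
  have hρB : BddMeas 𝒢 ρ := ⟨hρm, C, hρC⟩
  have hmem : ρ ∈ ArgminSet P 𝒢 u1 u2 α X := by
    refine ⟨hρB, fun W hW => ?_⟩
    rw [(hpi ρ hρB).2, (hpi W hW).2]
    exact integral_mono (hpi ρ hρB).1 (hpi W hW).1 fun ω => hρmin ω _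
  have hchar : ∀ Z ∈ ArgminSet P 𝒢 u1 u2 α X, ∀ᵐ ω ∂P, h ω (Z ω) = h ω (ρ ω) := by
    rintro Z ⟨hZ, hZm⟩
    have hle := hZm ρ hρB
    rw [(hpi ρ hρB).2, (hpi Z hZ).2] at hle
    have heq : ∫ ω, h ω (ρ ω) ∂P = ∫ ω, h ω (Z ω) ∂P :=
      le_antisymm (integral_mono (hpi ρ hρB).1 (hpi Z hZ).1 fun ω => hρmin ω _) hle
    have := (integral_eq_iff_of_ae_le (hpi ρ hρB).1 (hpi Z hZ).1
      (Eventually.of_forall fun ω => hρmin ω _)).1 heq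
    filter_upwards [this] with ω hω
    exact hω.symm
  refine ⟨⟨ρ, ⟨fun Z hZ => ?_, fun W hW => hW ρ hmem⟩, hmem⟩, ?_⟩
  · filter_upwards [hchar Z hZ] with ω hω
    exact hρsm ω _ hω.le
  · intro Z1 hZ1 Z2 hZ2
    have hB' : BddMeas 𝒢 (fun ω => min (Z1 ω) (Z2 ω)) := by
      obtain ⟨⟨m1, R1, hR1⟩, -⟩ := hZ1
      obtain ⟨⟨m2, R2, hR2⟩, -⟩ := hZ2
      exact ⟨m1.min m2, max R1 R2, fun ω =>
        abs_min_le_max_abs_abs.trans (max_le_max (hR1 ω) (hR2 ω))⟩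
    refine ⟨hB', fun W hW => ?_⟩
    refine le_trans (le_of_eq ?_) (hmem.2 W hW)
    rw [(hpi _ hB').2, (hpi ρ hρB).2]
    refine integral_congr_ae ?_
    filter_upwards [hchar Z1 hZ1, hchar Z2 hZ2] with ω e1 e2
    rcases min_choice (Z1 ω) (Z2 ω) with hm | hm
    · simp only [hm, e1]
    · simp only [hm, e2]
end

section
/- Let (Ω,F,P) be a non-atomic probability space, G ⊆ F a sub-σ-algebra, u1, u2 ∈ U⁺_icx, α ∈ (0,1) and X ∈ L∞(F). If u1 and u2 are differentiable with u1'(0) = u2'(0) = 0, then Z* ∈ L∞(G) is a minimizer of Z ↦ π_α(X,Z) over L∞(G) if and only if α·E[u1'((X−Z*)⁺) | G] = (1−α)·E[u2'((X−Z*)⁻) | G] P-a.s. -/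
open MeasureTheory Set Filter Topology

variable {Ω : Type*}

lemma aux_w_deriv {u : ℝ → ℝ} (h : Uicx u) (hd : DifferentiableOn ℝ u (Set.Ici 0))
    (h0 : derivWithin u (Set.Ici 0) 0 = 0) (x : ℝ) :
    HasDerivAt (fun x => u (max x 0)) (derivWithin u (Set.Ici 0) (max x 0)) x := by
  rcases lt_trichotomy x 0 with hx | hx | hx
  · rw [max_eq_right hx.le, h0]
    refine (hasDerivAt_const x (u 0)).congr_of_eventuallyEq ?_
    filter_upwards [Iio_mem_nhds hx] with y hy
    rw [max_eq_right (le_of_lt hy)]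
  · subst hx
    rw [max_self, h0]
    have hr : HasDerivWithinAt (fun x => u (max x 0)) 0 (Set.Ici 0) 0 := by
      have := (hd 0 (by simp)).hasDerivWithinAt
      rw [h0] at this
      exact this.congr (fun y hy => by rw [max_eq_left hy]) (by simp)
    have hl : HasDerivWithinAt (fun x => u (max x 0)) 0 (Set.Iic 0) 0 := by
      exact (hasDerivWithinAt_const (0:ℝ) (Set.Iic 0) (u 0)).congr
        (fun y hy => by rw [max_eq_right hy]) (by simp)
    have := hl.union hr
    rw [Set.Iic_union_Ici] at this
    exact hasDerivWithinAt_univ.1 this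
  · rw [max_eq_left hx.le]
    have hA := (hd x hx.le).hasDerivWithinAt.hasDerivAt (Ici_mem_nhds hx)
    refine hA.congr_of_eventuallyEq ?_
    filter_upwards [Ioi_mem_nhds hx] with y hy
    rw [max_eq_left (le_of_lt hy)]

lemma aux_w_convex {u : ℝ → ℝ} (h : Uicx u) : ConvexOn ℝ Set.univ (fun x => u (max x 0)) := by
  have hc : ConvexOn ℝ Set.univ (fun x : ℝ => max x 0) :=
    (convexOn_id convex_univ).sup (convexOn_const 0 convex_univ)
  refine ⟨convex_univ, fun x _ y _ a b ha hb hab => ?_⟩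
  have h3 := hc.2 (Set.mem_univ x) (Set.mem_univ y) ha hb hab
  have hx : max x 0 ∈ Set.Ici (0:ℝ) := Set.mem_Ici.2 (le_max_right _ _)
  have hy : max y 0 ∈ Set.Ici (0:ℝ) := Set.mem_Ici.2 (le_max_right _ _)
  exact (h.1.monotoneOn (Set.mem_Ici.2 (le_max_right _ _)) (h.2.1.1 hx hy ha hb hab) h3).trans
    (h.2.1.2 hx hy ha hb hab)

lemma aux_tangent {f f' : ℝ → ℝ} (hc : ConvexOn ℝ Set.univ f) (hd : ∀ x, HasDerivAt f (f' x) x)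
    (x y : ℝ) : f x + f' x * (y - x) ≤ f y := by
  rcases lt_trichotomy x y with h | h | h
  · have := hc.le_slope_of_hasDerivAt (mem_univ x) (mem_univ y) h (hd x)
    rw [slope_def_field, le_div_iff₀ (by linarith)] at this
    linarith
  · subst h; simp
  · have := hc.slope_le_of_hasDerivAt (mem_univ y) (mem_univ x) h (hd x)
    rw [slope_def_field, div_le_iff₀ (by linarith)] at this
    linarith

lemma aux_mono {f f' : ℝ → ℝ} (hc : ConvexOn ℝ Set.univ f) (hd : ∀ x, HasDerivAt f (f' x) x) :
    Monotone f' := by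
  intro x y hxy
  rcases hxy.eq_or_lt with h | h
  · rw [h]
  · have h1 := aux_tangent hc hd x y
    have h2 := aux_tangent hc hd y x
    by_contra hlt
    push Not at hlt
    nlinarith

lemma aux_bdd_int {mΩ : MeasurableSpace Ω} (P : Measure Ω) [IsProbabilityMeasure P]
    {Y : Ω → ℝ} (hY : BddMeas mΩ Y) : Integrable Y P := by
  obtain ⟨hm, C, hC⟩ := hY
  exact Integrable.of_bound hm.aestronglyMeasurable C (ae_of_all _ hC)

lemma aux_comp_cont {mΩ : MeasurableSpace Ω} {f : ℝ → ℝ} (hf : Continuous f)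
    {Y : Ω → ℝ} (hY : BddMeas mΩ Y) : BddMeas mΩ (fun ω => f (Y ω)) := by
  obtain ⟨hm, C, hC⟩ := hY
  refine ⟨hf.measurable.comp hm, ?_⟩
  obtain ⟨K, hK⟩ := (isCompact_Icc (a := -C) (b := C)).exists_bound_of_continuousOn hf.continuousOn
  exact ⟨K, fun ω => hK _ (abs_le.1 (hC ω))⟩

lemma aux_mono_bound {f : ℝ → ℝ} (hf : Monotone f) (C : ℝ) {y : ℝ} (hy : |y| ≤ C) :
    |f y| ≤ |f C| + |f (-C)| := by
  have h := abs_le.1 hy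
  have h1 := hf h.1
  have h2 := hf h.2
  rw [abs_le]
  have := neg_abs_le (f (-C))
  have := le_abs_self (f C)
  have := abs_nonneg (f C)
  have := abs_nonneg (f (-C))
  constructor <;> linarith

lemma aux_comp_mono {mΩ : MeasurableSpace Ω} {f : ℝ → ℝ} (hf : Monotone f)
    {Y : Ω → ℝ} (hY : BddMeas mΩ Y) : BddMeas mΩ (fun ω => f (Y ω)) := by
  obtain ⟨hm, C, hC⟩ := hY
  exact ⟨hf.measurable.comp hm, _, fun ω => aux_mono_bound hf C (hC ω)⟩

lemma aux_sub {mΩ : MeasurableSpace Ω} {Y W : Ω → ℝ} (hY : BddMeas mΩ Y) (hW : BddMeas mΩ W) :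
    BddMeas mΩ (fun ω => Y ω - W ω) := by
  obtain ⟨hm, C, hC⟩ := hY
  obtain ⟨hm', C', hC'⟩ := hW
  exact ⟨hm.sub hm', C + C', fun ω => (abs_sub _ _).trans (add_le_add (hC ω) (hC' ω))⟩

lemma aux_mul {mΩ : MeasurableSpace Ω} {Y W : Ω → ℝ} (hY : BddMeas mΩ Y) (hW : BddMeas mΩ W) :
    BddMeas mΩ (fun ω => Y ω * W ω) := by
  obtain ⟨hm, C, hC⟩ := hY
  obtain ⟨hm', C', hC'⟩ := hW
  refine ⟨hm.mul hm', C * C', fun ω => ?_⟩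
  rw [abs_mul]
  exact mul_le_mul (hC ω) (hC' ω) (abs_nonneg _) ((abs_nonneg _).trans (hC ω))

lemma aux_le_s4 {mΩ 𝒢 : MeasurableSpace Ω} (hG : 𝒢 ≤ mΩ) {Y : Ω → ℝ} (hY : BddMeas 𝒢 Y) :
    BddMeas mΩ Y := ⟨hY.1.mono hG le_rfl, hY.2⟩

/-- Abstract version for a single convex differentiable loss. -/
lemma aux_main (𝒢 : MeasurableSpace Ω) {mΩ : MeasurableSpace Ω} (P : Measure Ω)
    [IsProbabilityMeasure P] (hG : 𝒢 ≤ mΩ) {f f' : ℝ → ℝ} (hc : ConvexOn ℝ Set.univ f)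
    (hd : ∀ x, HasDerivAt f (f' x) x) (X : Ω → ℝ) (hX : BddMeas mΩ X)
    (Z : Ω → ℝ) (hZ : BddMeas 𝒢 Z) :
    (∀ W, BddMeas 𝒢 W → ∫ ω, f (X ω - Z ω) ∂P ≤ ∫ ω, f (X ω - W ω) ∂P) ↔
      P[fun ω => f' (X ω - Z ω)|𝒢] =ᵐ[P] 0 := by
  have hmono := aux_mono hc hd
  have hcont : Continuous f := continuous_iff_continuousAt.2 fun x => (hd x).continuousAt
  have hZm := aux_le_s4 hG hZ
  have hgB : BddMeas mΩ (fun ω => f' (X ω - Z ω)) := aux_comp_mono hmono (aux_sub hX hZm)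
  have hg := aux_bdd_int P hgB
  constructor
  · intro hmin
    symm
    refine ae_eq_condExp_of_forall_setIntegral_eq hG hg (fun s _ _ => integrableOn_zero) ?_
      (@stronglyMeasurable_zero Ω ℝ 𝒢 _ _).aestronglyMeasurable
    intro A hA _
    have hIG : BddMeas 𝒢 (A.indicator fun _ => (1:ℝ)) := by
      refine ⟨measurable_const.indicator hA, 1, fun ω => ?_⟩
      by_cases hω : ω ∈ A <;> simp [hω]
    have hI := aux_le_s4 hG hIG
    set I : Ω → ℝ := A.indicator fun _ => (1:ℝ) with hIdef
    have hI1 : ∀ ω, |I ω| ≤ 1 := by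
      intro ω
      by_cases hω : ω ∈ A <;> simp [hIdef, hω]
    have hWG : ∀ t : ℝ, BddMeas 𝒢 (fun ω => Z ω - t * I ω) := fun t =>
      aux_sub hZ (aux_mul (Y := fun _ => t) ⟨@measurable_const _ _ _ 𝒢 t, |t|, fun _ => le_rfl⟩ hIG)
    obtain ⟨C, hC⟩ := (aux_sub hX hZm).2
    have key := hasDerivAt_integral_of_dominated_loc_of_deriv_le (μ := P) (𝕜 := ℝ) (x₀ := 0)
      (s := Metric.ball 0 1)
      (F := fun t ω => f (X ω - (Z ω - t * I ω)))
      (F' := fun t ω => f' (X ω - (Z ω - t * I ω)) * I ω)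
      (bound := fun _ => |f' (C+1)| + |f' (-(C+1))|)
      (Metric.ball_mem_nhds 0 one_pos)
      (Eventually.of_forall fun t =>
        (aux_comp_cont hcont (aux_sub hX (aux_le_s4 hG (hWG t)))).1.aestronglyMeasurable)
      (aux_bdd_int P (aux_comp_cont hcont (aux_sub hX (aux_le_s4 hG (hWG 0)))))
      (aux_mul (aux_comp_mono hmono (aux_sub hX (aux_le_s4 hG (hWG 0)))) hI).1.aestronglyMeasurable
      (by
        refine ae_of_all _ fun ω t ht => ?_
        rw [Metric.mem_ball, dist_zero_right, Real.norm_eq_abs] at ht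
        have hb : |X ω - (Z ω - t * I ω)| ≤ C + 1 := by
          have e : X ω - (Z ω - t * I ω) = (X ω - Z ω) + t * I ω := by ring
          rw [e]
          refine (abs_add_le _ _).trans (add_le_add (hC ω) ?_)
          rw [abs_mul]
          exact mul_le_one₀ ht.le (abs_nonneg _) (hI1 ω)
        have h1 := aux_mono_bound hmono (C+1) hb
        rw [Real.norm_eq_abs, abs_mul]
        exact (mul_le_of_le_one_right (abs_nonneg _) (hI1 ω)).trans h1)
      (integrable_const _)
      (by
        refine ae_of_all _ fun ω t _ => ?_
        have hin : HasDerivAt (fun t : ℝ => X ω - (Z ω - t * I ω)) (I ω) t := by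
          have := (((hasDerivAt_id t).mul_const (I ω)).const_sub (Z ω)).const_sub (X ω)
          simpa using this
        exact (hd _).comp t hin)
    have hmin0 : IsLocalMin (fun t : ℝ => ∫ ω, f (X ω - (Z ω - t * I ω)) ∂P) 0 := by
      refine Eventually.of_forall fun t => ?_
      simpa using hmin _ (hWG t)
    have h0 := hmin0.hasDerivAt_eq_zero key.2
    simp only [Pi.zero_apply, integral_zero]
    rw [← integral_indicator (hG _ hA), ← h0]
    refine integral_congr_ae (ae_of_all _ fun ω => ?_)
    by_cases hω : ω ∈ A <;> simp [hIdef, hω]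
  · intro hce W hW
    have hWm := aux_le_s4 hG hW
    have hDG := aux_sub hZ hW
    have hD := aux_le_s4 hG hDG
    have hprod := aux_bdd_int P (aux_mul hgB hD)
    have hzero : ∫ ω, f' (X ω - Z ω) * (Z ω - W ω) ∂P = 0 := by
      have h1 := condExp_mul_of_stronglyMeasurable_right (μ := P) (m := 𝒢)
        (f := fun ω => f' (X ω - Z ω)) (g := fun ω => Z ω - W ω)
        hDG.1.stronglyMeasurable hprod hg
      have h2 := integral_condExp (μ := P) (f := (fun ω => f' (X ω - Z ω)) * (fun ω => Z ω - W ω)) hG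
      have h3 : ∫ ω, f' (X ω - Z ω) * (Z ω - W ω) ∂P
        = ∫ ω, ((fun ω => f' (X ω - Z ω)) * (fun ω => Z ω - W ω)) ω ∂P := rfl
      rw [h3, ← h2]
      refine integral_eq_zero_of_ae ?_
      filter_upwards [h1, hce] with ω e1 e2
      rw [e1, Pi.mul_apply, e2]; simp
    have hfZ := aux_bdd_int P (aux_comp_cont hcont (aux_sub hX hZm))
    have hfW := aux_bdd_int P (aux_comp_cont hcont (aux_sub hX hWm))
    have hle := integral_mono (hfZ.add hprod) hfW (fun ω => by
      have := aux_tangent hc hd (X ω - Z ω) (X ω - W ω)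
      have e : X ω - W ω - (X ω - Z ω) = Z ω - W ω := by ring
      rw [e] at this
      exact this)
    rw [integral_add' hfZ hprod, hzero, add_zero] at hle
    exact hle

/-- Proposition 3.1 (ii): if `u1, u2` are differentiable with
`u1'(0) = u2'(0) = 0`, then `Z* ∈ L∞(𝒢)` is a minimizer of `Z ↦ π_α(X,Z)` over `L∞(𝒢)` if
and only if `α·E[u1'((X−Z*)⁺)|𝒢] = (1−α)·E[u2'((X−Z*)⁻)|𝒢]` a.s. -/
theorem conditional_generalized_quantile_first_order_condition_differentiable
    [mΩ : MeasurableSpace Ω] (P : Measure Ω) [IsProbabilityMeasure P]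
    (hP : Nonatomic P) (𝒢 : MeasurableSpace Ω) (hG : 𝒢 ≤ mΩ)
    {u1 u2 : ℝ → ℝ} (h1 : Uicx u1) (h2 : Uicx u2)
    (hdiff1 : DifferentiableOn ℝ u1 (Set.Ici 0))
    (hdiff2 : DifferentiableOn ℝ u2 (Set.Ici 0))
    (hd10 : derivWithin u1 (Set.Ici 0) 0 = 0)
    (hd20 : derivWithin u2 (Set.Ici 0) 0 = 0)
    {α : ℝ} (hα : α ∈ Set.Ioo (0:ℝ) 1)
    (X : Ω → ℝ) (hX : BddMeas mΩ X)
    (Zstar : Ω → ℝ) (hZ : BddMeas 𝒢 Zstar) :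
    Zstar ∈ ArgminSet P 𝒢 u1 u2 α X ↔
      (fun ω => α * (P[fun ω' => derivWithin u1 (Set.Ici 0) (max (X ω' - Zstar ω') 0)|𝒢]) ω)
        =ᵐ[P]
      (fun ω => (1 - α) *
          (P[fun ω' => derivWithin u2 (Set.Ici 0) (max (Zstar ω' - X ω') 0)|𝒢]) ω) := by
  have hα0 := hα.1
  have hα1 : 0 < 1 - α := sub_pos.2 hα.2
  have hd1 := aux_w_deriv h1 hdiff1 hd10
  have hd2 := aux_w_deriv h2 hdiff2 hd20
  have hc1 := aux_w_convex h1
  have hc2 := aux_w_convex h2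
  have hm1 := aux_mono hc1 hd1
  have hm2 := aux_mono hc2 hd2
  have hk1 : Continuous fun x => u1 (max x 0) :=
    continuous_iff_continuousAt.2 fun x => (hd1 x).continuousAt
  have hk2 : Continuous fun x => u2 (max x 0) :=
    continuous_iff_continuousAt.2 fun x => (hd2 x).continuousAt
  have hc : ConvexOn ℝ Set.univ
      (fun x => α * u1 (max x 0) + (1 - α) * u2 (max (-x) 0)) := by
    refine (hc1.smul hα0.le).add (ConvexOn.smul hα1.le ?_)
    exact hc2.comp_linearMap (-LinearMap.id)
  have hd : ∀ x, HasDerivAt (fun x => α * u1 (max x 0) + (1 - α) * u2 (max (-x) 0))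
      (α * derivWithin u1 (Set.Ici 0) (max x 0)
        - (1 - α) * derivWithin u2 (Set.Ici 0) (max (-x) 0)) x := by
    intro x
    have h3 := ((hd2 (-x)).comp x (hasDerivAt_neg x)).const_mul (1 - α)
    have h4 := ((hd1 x).const_mul α).add h3
    refine h4.congr_deriv ?_
    ring
  have main := aux_main 𝒢 P hG hc hd X hX Zstar hZ
  have hpi : ∀ W, BddMeas 𝒢 W → piRisk P u1 u2 α X W =
      ∫ ω, (α * u1 (max (X ω - W ω) 0) + (1 - α) * u2 (max (-(X ω - W ω)) 0)) ∂P := by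
    intro W hW
    have hWm := aux_le_s4 hG hW
    have i1 := aux_bdd_int P (aux_comp_cont hk1 (aux_sub hX hWm))
    have i2 := aux_bdd_int P (aux_comp_cont hk2 (aux_sub hWm hX))
    simp only [neg_sub]
    rw [integral_add (i1.const_mul α) (i2.const_mul (1 - α)), integral_const_mul,
      integral_const_mul]
    rfl
  have hZm := aux_le_s4 hG hZ
  have j1 := aux_bdd_int P (aux_comp_mono hm1 (aux_sub hX hZm))
  have j2 := aux_bdd_int P (aux_comp_mono hm2 (aux_sub hZm hX))
  have hce : P[fun ω => α * derivWithin u1 (Set.Ici 0) (max (X ω - Zstar ω) 0)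
        - (1 - α) * derivWithin u2 (Set.Ici 0) (max (-(X ω - Zstar ω)) 0)|𝒢] =ᵐ[P]
      fun ω => α * (P[fun ω' => derivWithin u1 (Set.Ici 0) (max (X ω' - Zstar ω') 0)|𝒢]) ω
        - (1 - α) *
          (P[fun ω' => derivWithin u2 (Set.Ici 0) (max (Zstar ω' - X ω') 0)|𝒢]) ω := by
    simp only [neg_sub]
    have k := condExp_sub (j1.const_mul α) (j2.const_mul (1 - α)) 𝒢
    have k1 := condExp_smul (μ := P) α
      (fun ω' => derivWithin u1 (Set.Ici 0) (max (X ω' - Zstar ω') 0)) 𝒢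
    have k2 := condExp_smul (μ := P) (1 - α)
      (fun ω' => derivWithin u2 (Set.Ici 0) (max (Zstar ω' - X ω') 0)) 𝒢
    refine k.trans ?_
    filter_upwards [k1, k2] with ω e1 e2
    rw [Pi.sub_apply]
    exact congrArg₂ (· - ·) e1 e2
  have lhs : Zstar ∈ ArgminSet P 𝒢 u1 u2 α X ↔
      ∀ W, BddMeas 𝒢 W → piRisk P u1 u2 α X Zstar ≤ piRisk P u1 u2 α X W :=
    ⟨fun h => h.2, fun h => ⟨hZ, h⟩⟩
  rw [lhs]
  have l2 : (∀ W, BddMeas 𝒢 W → piRisk P u1 u2 α X Zstar ≤ piRisk P u1 u2 α X W) ↔ _ :=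
    (forall₂_congr fun W hW => by rw [hpi W hW, hpi Zstar hZ]).trans main
  rw [l2]
  constructor
  · intro h
    filter_upwards [h, hce] with ω e1 e2
    rw [e1] at e2
    exact (sub_eq_zero.1 e2.symm)
  · intro h
    filter_upwards [h, hce] with ω e1 e2
    rw [e2, e1]
    simp
end

section
/- Let (Ω,F,P) be a non-atomic probability space, G ⊆ F a sub-σ-algebra, X ∈ L∞(F), and let v ∈ V, i.e. v : ℝ → ℝ is increasing with v(0−) ≤ 0 and v(0+) ≥ 0. Then for any α ∈ (0,1), the conditional shortfall risk measure satisfies ρ_v^G(X) = ρ_α^G(X) P-a.s., where ρ_α^G is the conditional generalized quantile built from the increasing convex functions u1(x) = (1/α)·∫_0^x v(t) dt and u2(x) = −(1/(1−α))·∫_{−x}^0 v(t) dt for x ≥ 0. -/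
open MeasureTheory Set Filter Topology

variable {Ω : Type*}

/-- Locally bounded function. -/
def LocBdd (g : ℝ → ℝ) : Prop := ∀ C : ℝ, ∃ K : ℝ, ∀ y, |y| ≤ C → |g y| ≤ K

lemma locBdd_mono {v : ℝ → ℝ} (hv : Monotone v) : LocBdd v := by
  intro C
  refine ⟨max |v C| |v (-C)|, fun y hy => ?_⟩
  have h1 := hv (abs_le.1 hy).1
  have h2 := hv (abs_le.1 hy).2
  exact abs_le_max_abs_abs h1 h2 |>.trans (by rw [max_comm])

lemma locBdd_cont {g : ℝ → ℝ} (hg : Continuous g) : LocBdd g := by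
  intro C
  obtain ⟨K, hK⟩ := (isCompact_Icc (a := -C) (b := C)).exists_bound_of_continuousOn hg.continuousOn
  exact ⟨K, fun y hy => by simpa using hK y (abs_le.1 hy)⟩

lemma BddMeas.mono {𝒢 m : MeasurableSpace Ω} (h : 𝒢 ≤ m) {Z : Ω → ℝ} (hZ : BddMeas 𝒢 Z) :
    BddMeas m Z := ⟨hZ.1.mono h le_rfl, hZ.2⟩

lemma BddMeas.const (m : MeasurableSpace Ω) (c : ℝ) : BddMeas m (fun _ : Ω => c) :=
  ⟨measurable_const, |c|, fun _ => le_rfl⟩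

lemma BddMeas.sub {m : MeasurableSpace Ω} {Y Z : Ω → ℝ} (hY : BddMeas m Y) (hZ : BddMeas m Z) :
    BddMeas m (fun ω => Y ω - Z ω) := by
  obtain ⟨hY, C, hC⟩ := hY
  obtain ⟨hZ, D, hD⟩ := hZ
  refine ⟨hY.sub hZ, C + D, fun ω => (abs_sub _ _).trans (add_le_add (hC ω) (hD ω))⟩

lemma BddMeas.min {m : MeasurableSpace Ω} {Y Z : Ω → ℝ} (hY : BddMeas m Y) (hZ : BddMeas m Z) :
    BddMeas m (fun ω => min (Y ω) (Z ω)) := by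
  obtain ⟨hY, C, hC⟩ := hY
  obtain ⟨hZ, D, hD⟩ := hZ
  refine ⟨hY.min hZ, max C D, fun ω => abs_min_le_max_abs_abs.trans (max_le_max (hC ω) (hD ω))⟩

lemma BddMeas.max {m : MeasurableSpace Ω} {Y Z : Ω → ℝ} (hY : BddMeas m Y) (hZ : BddMeas m Z) :
    BddMeas m (fun ω => max (Y ω) (Z ω)) := by
  obtain ⟨hY, C, hC⟩ := hY
  obtain ⟨hZ, D, hD⟩ := hZ
  refine ⟨hY.max hZ, Max.max C D, fun ω => abs_max_le_max_abs_abs.trans (max_le_max (hC ω) (hD ω))⟩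

open Classical in
lemma BddMeas.piecewise {m : MeasurableSpace Ω} {Y Z : Ω → ℝ} (hY : BddMeas m Y)
    (hZ : BddMeas m Z) {A : Set Ω} (hA : MeasurableSet[m] A) :
    BddMeas m (A.piecewise Y Z) := by
  obtain ⟨hY, C, hC⟩ := hY
  obtain ⟨hZ, D, hD⟩ := hZ
  refine ⟨hY.piecewise hA hZ, Max.max C D, fun ω => ?_⟩
  by_cases h : ω ∈ A
  · simpa [h] using Or.inl (hC ω)
  · simpa [h] using Or.inr (hD ω)

lemma BddMeas.comp {m : MeasurableSpace Ω} {Y : Ω → ℝ} (hY : BddMeas m Y) {g : ℝ → ℝ}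
    (hg : Measurable g) (hb : LocBdd g) : BddMeas m (fun ω => g (Y ω)) := by
  obtain ⟨hY, C, hC⟩ := hY
  obtain ⟨K, hK⟩ := hb C
  exact ⟨hg.comp hY, K, fun ω => hK _ (hC ω)⟩

lemma BddMeas.integrable {m : MeasurableSpace Ω} {P : Measure Ω} [IsFiniteMeasure P]
    {Y : Ω → ℝ} (hY : BddMeas m Y) : Integrable Y P := by
  obtain ⟨hY, C, hC⟩ := hY
  exact Integrable.of_bound hY.aestronglyMeasurable C (Eventually.of_forall hC)

/-- the convex primitive -/
noncomputable def prim (v : ℝ → ℝ) (x : ℝ) : ℝ := ∫ t in (0:ℝ)..x, v t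

lemma prim_cont {v : ℝ → ℝ} (hv : Monotone v) : Continuous (prim v) :=
  intervalIntegral.continuous_primitive (fun _ _ => hv.intervalIntegrable) 0

lemma prim_subgrad {v : ℝ → ℝ} (hv : Monotone v) (x y : ℝ) :
    prim v x + v x * (y - x) ≤ prim v y := by
  have h : prim v y - prim v x = ∫ t in x..y, v t :=
    intervalIntegral.integral_interval_sub_left hv.intervalIntegrable hv.intervalIntegrable
  rcases le_total x y with hxy | hxy
  · have : ∫ t in x..y, v x ≤ ∫ t in x..y, v t :=
      intervalIntegral.integral_mono_on hxy (by simp) hv.intervalIntegrable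
        (fun t ht => hv ht.1)
    simp at this
    linarith
  · have : ∫ t in y..x, v t ≤ ∫ t in y..x, v x :=
      intervalIntegral.integral_mono_on hxy hv.intervalIntegrable (by simp)
        (fun t ht => hv ht.2)
    rw [intervalIntegral.integral_symm] at h
    simp at this
    linarith

lemma piRisk_eq {m : MeasurableSpace Ω} (P : Measure Ω) [IsProbabilityMeasure P]
    {X Z : Ω → ℝ} (hX : BddMeas m X) (hZ : BddMeas m Z) {v : ℝ → ℝ} (hv : Monotone v)
    {α : ℝ} (hα : α ∈ Set.Ioo (0:ℝ) 1) :
    piRisk P (fun x => (1 / α) * ∫ t in (0:ℝ)..x, v t)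
        (fun x => -(1 / (1 - α)) * ∫ t in (-x)..(0:ℝ), v t) α X Z
      = ∫ ω, prim v (X ω - Z ω) ∂P := by
  have h0 : α ≠ 0 := hα.1.ne'
  have h1 : 1 - α ≠ 0 := (sub_pos.2 hα.2).ne'
  have hc := prim_cont hv
  have i1 : Integrable (fun ω => prim v (max (X ω - Z ω) 0)) P :=
    (((hX.sub hZ).max (BddMeas.const m 0)).comp hc.measurable (locBdd_cont hc)).integrable
  have hc2 : Continuous fun x => prim v (-x) := hc.comp continuous_neg
  have i2 : Integrable (fun ω => prim v (-(max (Z ω - X ω) 0))) P :=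
    (((hZ.sub hX).max (BddMeas.const m 0)).comp hc2.measurable (locBdd_cont hc2)).integrable
  have e1 : ∀ y : ℝ, (1 / α) * (∫ t in (0:ℝ)..y, v t) = (1 / α) * prim v y := fun y => rfl
  have e2 : ∀ y : ℝ, -(1 / (1 - α)) * (∫ t in (-y)..(0:ℝ), v t)
      = (1 / (1 - α)) * prim v (-y) := fun y => by
    rw [intervalIntegral.integral_symm, prim]; ring
  unfold piRisk
  simp only [e1, e2]
  rw [integral_const_mul, integral_const_mul, ← mul_assoc, ← mul_assoc, mul_one_div_cancel h0,
    mul_one_div_cancel h1, one_mul, one_mul, ← integral_add i1 i2]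
  congr 1
  ext ω
  have z : prim v 0 = 0 := by simp [prim]
  rcases le_total (X ω) (Z ω) with h | h
  · rw [max_eq_right (by linarith), max_eq_left (by linarith), z, zero_add, neg_sub]
  · rw [max_eq_left (by linarith), max_eq_right (by linarith), neg_zero, z, add_zero]

/-- continuity of the functional under bounded pointwise convergence -/
lemma tendsto_risk {m : MeasurableSpace Ω} (P : Measure Ω) [IsProbabilityMeasure P]
    {X : Ω → ℝ} (hX : BddMeas m X) {v : ℝ → ℝ} (hv : Monotone v)
    {Zn : ℕ → Ω → ℝ} {Z : Ω → ℝ} {C : ℝ} (hm : ∀ n, Measurable (Zn n))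
    (hC : ∀ n ω, |Zn n ω| ≤ C)
    (ht : ∀ ω, Tendsto (fun n => Zn n ω) atTop (𝓝 (Z ω))) :
    Tendsto (fun n => ∫ ω, prim v (X ω - Zn n ω) ∂P) atTop
      (𝓝 (∫ ω, prim v (X ω - Z ω) ∂P)) := by
  have hc := prim_cont hv
  obtain ⟨D, hD⟩ := hX.2
  obtain ⟨K, hK⟩ := locBdd_cont hc (D + C)
  refine tendsto_integral_of_dominated_convergence (fun _ => K) ?_ (integrable_const K) ?_ ?_
  · exact fun n => (hc.measurable.comp (hX.1.sub (hm n))).aestronglyMeasurable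
  · exact fun n => Eventually.of_forall fun ω =>
      hK _ ((abs_sub _ _).trans (add_le_add (hD ω) (hC n ω)))
  · exact Eventually.of_forall fun ω =>
      (hc.tendsto _).comp (tendsto_const_nhds.sub (ht ω))

lemma integral_condExp_mul {mΩ : MeasurableSpace Ω} (P : Measure Ω) [IsProbabilityMeasure P]
    {𝒢 : MeasurableSpace Ω} (hG : 𝒢 ≤ mΩ) {g Y : Ω → ℝ} (hg : BddMeas mΩ g)
    (hY : BddMeas 𝒢 Y) : ∫ ω, g ω * Y ω ∂P = ∫ ω, (P[g|𝒢]) ω * Y ω ∂P := by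
  rw [← integral_condExp hG]
  have hYi := (hY.mono hG)
  obtain ⟨C, hC⟩ := hY.2
  refine integral_congr_ae ?_
  have hi : Integrable (g * Y) P :=
    hg.integrable.mul_bdd hYi.1.aestronglyMeasurable (Eventually.of_forall hC)
  exact condExp_mul_of_stronglyMeasurable_right hY.1.stronglyMeasurable hi hg.integrable

/-- directional minimality from first-order condition -/
lemma risk_le {mΩ : MeasurableSpace Ω} (P : Measure Ω) [IsProbabilityMeasure P]
    {𝒢 : MeasurableSpace Ω} (hG : 𝒢 ≤ mΩ) {X Z W : Ω → ℝ} (hX : BddMeas mΩ X)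
    (hZ : BddMeas 𝒢 Z) (hW : BddMeas 𝒢 W) {v : ℝ → ℝ} (hv : Monotone v)
    (h : ∀ᵐ ω ∂P, 0 ≤ (P[fun ω' => v (X ω' - Z ω')|𝒢]) ω * (Z ω - W ω)) :
    ∫ ω, prim v (X ω - Z ω) ∂P ≤ ∫ ω, prim v (X ω - W ω) ∂P := by
  have hc := prim_cont hv
  have hg := (hX.sub (hZ.mono hG)).comp hv.measurable (locBdd_mono hv)
  have hd := hZ.sub hW
  have hi : Integrable (fun ω => v (X ω - Z ω) * (Z ω - W ω)) P := by
    obtain ⟨C, hC⟩ := hd.2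
    exact hg.integrable.mul_bdd (hd.mono hG).1.aestronglyMeasurable (Eventually.of_forall hC)
  have i1 : Integrable (fun ω => prim v (X ω - Z ω)) P :=
    ((hX.sub (hZ.mono hG)).comp hc.measurable (locBdd_cont hc)).integrable
  have i2 : Integrable (fun ω => prim v (X ω - W ω)) P :=
    ((hX.sub (hW.mono hG)).comp hc.measurable (locBdd_cont hc)).integrable
  have h1 : 0 ≤ ∫ ω, v (X ω - Z ω) * (Z ω - W ω) ∂P := by
    rw [integral_condExp_mul P hG hg hd]
    exact integral_nonneg_of_ae h
  have h2 : ∫ ω, (prim v (X ω - Z ω) + v (X ω - Z ω) * (Z ω - W ω)) ∂P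
      ≤ ∫ ω, prim v (X ω - W ω) ∂P := by
    refine integral_mono (i1.add hi) i2 fun ω => ?_
    have := prim_subgrad hv (X ω - Z ω) (X ω - W ω)
    have e : X ω - W ω - (X ω - Z ω) = Z ω - W ω := by ring
    rw [e] at this
    exact this
  rw [integral_add i1 hi] at h2
  linarith

lemma condExp_nonpos_of {mΩ : MeasurableSpace Ω} (P : Measure Ω) [IsProbabilityMeasure P]
    {𝒢 : MeasurableSpace Ω} (hG : 𝒢 ≤ mΩ) {g : Ω → ℝ} (hg : Integrable g P)
    (h : ∀ A, MeasurableSet[𝒢] A → ∫ ω in A, g ω ∂P ≤ 0) :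
    ∀ᵐ ω ∂P, (P[g|𝒢]) ω ≤ 0 := by
  have hm : Measurable[𝒢] (P[g|𝒢]) := stronglyMeasurable_condExp.measurable
  have hA : MeasurableSet[𝒢] {ω | 0 < (P[g|𝒢]) ω} := measurableSet_lt measurable_const hm
  have h1 := h _ hA
  rw [← setIntegral_condExp hG hg hA] at h1
  have h2 : ∫ ω in {ω | 0 < (P[g|𝒢]) ω}, (P[g|𝒢]) ω ∂P = 0 :=
    le_antisymm h1 (setIntegral_nonneg (hG _ hA) fun ω hω => le_of_lt hω)
  have h3 := (setIntegral_eq_zero_iff_of_nonneg_ae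
    ((ae_restrict_iff' (hG _ hA)).2 (Eventually.of_forall fun ω hω => le_of_lt hω))
    integrable_condExp.integrableOn).1 h2
  rw [EventuallyEq, ae_restrict_iff' (hG _ hA)] at h3
  filter_upwards [h3] with ω hω
  by_contra hc
  push Not at hc
  have := hω hc
  simp at this
  linarith

open Classical in
lemma paste {mΩ : MeasurableSpace Ω} (P : Measure Ω) [IsProbabilityMeasure P]
    {𝒢 : MeasurableSpace Ω} (hG : 𝒢 ≤ mΩ) {X Y Z : Ω → ℝ} (hX : BddMeas mΩ X)
    {v : ℝ → ℝ} (hv : Monotone v) (hY : BddMeas 𝒢 Y) (hZ : Z ∈ ShortfallSet P 𝒢 v X)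
    {A : Set Ω} (hA : MeasurableSet[𝒢] A)
    (h : ∀ᵐ ω ∂P, ω ∈ A → (P[fun ω' => v (X ω' - Y ω')|𝒢]) ω ≤ 0) :
    A.piecewise Y Z ∈ ShortfallSet P 𝒢 v X := by
  have iY : Integrable (fun ω => v (X ω - Y ω)) P :=
    ((hX.sub (hY.mono hG)).comp hv.measurable (locBdd_mono hv)).integrable
  have iZ : Integrable (fun ω => v (X ω - Z ω)) P :=
    ((hX.sub (hZ.1.mono hG)).comp hv.measurable (locBdd_mono hv)).integrable
  refine ⟨hY.piecewise hZ.1 hA, ?_⟩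
  have e : (fun ω => v (X ω - A.piecewise Y Z ω))
      = A.indicator (fun ω => v (X ω - Y ω)) + Aᶜ.indicator (fun ω => v (X ω - Z ω)) := by
    ext ω
    by_cases hω : ω ∈ A <;> simp [hω]
  rw [e]
  have a1 := condExp_add (iY.indicator (hG _ hA)) (iZ.indicator (hG _ hA.compl)) 𝒢
  filter_upwards [a1, condExp_indicator iY hA, condExp_indicator iZ hA.compl, h, hZ.2]
    with ω h1 h2 h3 h4 h5
  rw [h1, Pi.add_apply, h2, h3]
  by_cases hω : ω ∈ A
  · simpa [hω] using h4 hω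
  · simpa [hω] using h5

lemma shortfall_min {mΩ : MeasurableSpace Ω} (P : Measure Ω) [IsProbabilityMeasure P]
    {𝒢 : MeasurableSpace Ω} (hG : 𝒢 ≤ mΩ) {X Y Z : Ω → ℝ} (hX : BddMeas mΩ X)
    {v : ℝ → ℝ} (hv : Monotone v) (hY : Y ∈ ShortfallSet P 𝒢 v X)
    (hZ : Z ∈ ShortfallSet P 𝒢 v X) :
    (fun ω => min (Y ω) (Z ω)) ∈ ShortfallSet P 𝒢 v X := by
  classical
  have hA : MeasurableSet[𝒢] {ω | Y ω ≤ Z ω} := measurableSet_le hY.1.1 hZ.1.1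
  convert paste P hG hX hv hY.1 hZ hA (hY.2.mono fun ω h _ => h) using 1
  ext ω
  by_cases h : Y ω ≤ Z ω
  · simp [Set.piecewise, h]
  · simp [Set.piecewise, h, le_of_lt (not_le.1 h)]

lemma shortfall_up {mΩ : MeasurableSpace Ω} (P : Measure Ω) [IsProbabilityMeasure P]
    {𝒢 : MeasurableSpace Ω} (hG : 𝒢 ≤ mΩ) {X Y Z : Ω → ℝ} (hX : BddMeas mΩ X)
    {v : ℝ → ℝ} (hv : Monotone v) (hZ : Z ∈ ShortfallSet P 𝒢 v X)
    (hY : BddMeas 𝒢 Y) (hle : ∀ ω, Z ω ≤ Y ω) :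
    Y ∈ ShortfallSet P 𝒢 v X := by
  have iY : Integrable (fun ω => v (X ω - Y ω)) P :=
    ((hX.sub (hY.mono hG)).comp hv.measurable (locBdd_mono hv)).integrable
  have iZ : Integrable (fun ω => v (X ω - Z ω)) P :=
    ((hX.sub (hZ.1.mono hG)).comp hv.measurable (locBdd_mono hv)).integrable
  refine ⟨hY, ?_⟩
  have := condExp_mono (m := 𝒢) iY iZ
    (Eventually.of_forall fun ω => hv (sub_le_sub_left (hle ω) (X ω)))
  filter_upwards [this, hZ.2] with ω h1 h2 using h1.trans h2

/-- essential infimum of a min-stable family, uniformly bounded below -/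
lemma exists_essinf {mΩ : MeasurableSpace Ω} (P : Measure Ω) [IsProbabilityMeasure P]
    {𝒢 : MeasurableSpace Ω} (hG : 𝒢 ≤ mΩ) (S : Set (Ω → ℝ)) (hS : ∀ Z ∈ S, BddMeas 𝒢 Z)
    (hmin : ∀ Y ∈ S, ∀ Z ∈ S, (fun ω => min (Y ω) (Z ω)) ∈ S)
    (L M : ℝ) (hL : ∀ Z ∈ S, ∀ ω, L ≤ Z ω) (hM : (fun _ => M) ∈ S) :
    ∃ (W : ℕ → Ω → ℝ) (Z : Ω → ℝ), (∀ n, W n ∈ S) ∧ (∀ n ω, W n ω ≤ M) ∧ BddMeas 𝒢 Z ∧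
      (∀ n ω, Z ω ≤ W n ω) ∧
      (∀ ω, Tendsto (fun n => W n ω) atTop (𝓝 (Z ω))) ∧ ∀ Y ∈ S, Z ≤ᵐ[P] Y := by
  let I : Set ℝ := (fun Z : Ω → ℝ => ∫ ω, Z ω ∂P) '' S
  have hIne : I.Nonempty := ⟨_, _, hM, rfl⟩
  have hint : ∀ Z ∈ S, Integrable Z P := fun Z hZ => ((hS Z hZ).mono hG).integrable
  have hIb : BddBelow I := by
    refine ⟨L, ?_⟩
    rintro _ ⟨Z, hZ, rfl⟩
    have := integral_mono (integrable_const (μ := P) L) (hint Z hZ) (hL Z hZ)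
    simpa using this
  have hex : ∀ n : ℕ, ∃ Z ∈ S, ∫ ω, Z ω ∂P < sInf I + 1 / ((n:ℝ) + 1) := by
    intro n
    have hp : (0:ℝ) < 1 / ((n:ℝ) + 1) := by positivity
    obtain ⟨_, ⟨Z, hZ, rfl⟩, hlt⟩ := Real.lt_sInf_add_pos hIne hp
    exact ⟨Z, hZ, hlt⟩
  choose V hVS hV using hex
  let W : ℕ → Ω → ℝ := fun n => Nat.rec (fun _ => M) (fun k w ω => min (w ω) (V k ω)) n
  have W0 : W 0 = fun _ => M := rfl
  have Ws : ∀ n, W (n + 1) = fun ω => min (W n ω) (V n ω) := fun n => rfl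
  have hWS : ∀ n, W n ∈ S := by
    intro n
    induction n with
    | zero => exact hM
    | succ k ih => rw [Ws]; exact hmin _ ih _ (hVS k)
  have hanti : ∀ ω, Antitone fun n => W n ω := fun ω =>
    antitone_nat_of_succ_le fun n => by rw [Ws]; exact min_le_left _ _
  have hb : ∀ ω, BddBelow (range fun n => W n ω) := fun ω =>
    ⟨L, by rintro _ ⟨n, rfl⟩; exact hL _ (hWS n) ω⟩
  have hWM : ∀ n ω, W n ω ≤ M := fun n ω => hanti ω (Nat.zero_le n)
  refine ⟨W, fun ω => ⨅ n, W n ω, hWS, hWM, ⟨?_, max |L| |M|, ?_⟩, fun n ω => ciInf_le (hb ω) n,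
    fun ω => tendsto_atTop_ciInf (hanti ω) (hb ω), ?_⟩
  · exact Measurable.iInf (fun n => (hS _ (hWS n)).1)
  · intro ω
    exact abs_le_max_abs_abs (le_ciInf fun n => hL _ (hWS n) ω) ((ciInf_le (hb ω) 0).trans (hWM 0 ω))
  · intro Y hY
    set Z : Ω → ℝ := fun ω => ⨅ n, W n ω with hZdef
    have hZm : Measurable[mΩ] Z := Measurable.iInf fun n => ((hS _ (hWS n)).mono hG).1
    have hZb : BddMeas mΩ Z := ⟨hZm, max |L| |M|, fun ω =>
      abs_le_max_abs_abs (le_ciInf fun n => hL _ (hWS n) ω) ((ciInf_le (hb ω) 0).trans (hWM 0 ω))⟩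
    have hYb := (hS Y hY).mono hG
    have hZV : ∀ n ω, Z ω ≤ V n ω := fun n ω =>
      (ciInf_le (hb ω) (n + 1)).trans (by rw [Ws]; exact min_le_right _ _)
    have hi : Integrable (fun ω => max (Z ω - Y ω) 0) P :=
      ((hZb.sub hYb).max (BddMeas.const mΩ 0)).integrable
    have key : ∀ n : ℕ, ∫ ω, max (Z ω - Y ω) 0 ∂P ≤ 1 / ((n:ℝ) + 1) := by
      intro n
      have hmn := hmin _ (hVS n) _ hY
      have h1 : sInf I ≤ ∫ ω, min (V n ω) (Y ω) ∂P := csInf_le hIb ⟨_, hmn, rfl⟩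
      have h2 : ∫ ω, max (Z ω - Y ω) 0 ∂P ≤ ∫ ω, (V n ω - min (V n ω) (Y ω)) ∂P := by
        refine integral_mono hi ((hint _ (hVS n)).sub (hint _ hmn)) fun ω => ?_
        have := hZV n ω
        refine max_le ?_ (sub_nonneg.2 (min_le_left _ _))
        have := min_le_right (V n ω) (Y ω)
        linarith
      rw [integral_sub (hint _ (hVS n)) (hint _ hmn)] at h2
      have := hV n
      linarith
    have h0 : ∫ ω, max (Z ω - Y ω) 0 ∂P ≤ 0 :=
      ge_of_tendsto' tendsto_one_div_add_atTop_nhds_zero_nat key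
    have hz := (integral_eq_zero_iff_of_nonneg (fun ω => le_max_right _ _) hi).1
      (le_antisymm h0 (integral_nonneg fun ω => le_max_right _ _))
    filter_upwards [hz] with ω hω
    have := le_max_left (Z ω - Y ω) 0
    simp only [Pi.zero_apply] at hω
    linarith

/-- a minimizer shifted up by `ε` is acceptable -/
lemma argmin_add_mem {mΩ : MeasurableSpace Ω} (P : Measure Ω) [IsProbabilityMeasure P]
    {𝒢 : MeasurableSpace Ω} (hG : 𝒢 ≤ mΩ) {X Z : Ω → ℝ} (hX : BddMeas mΩ X)
    {v : ℝ → ℝ} (hv : Monotone v) (hZ : BddMeas 𝒢 Z)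
    (h : ∀ W, BddMeas 𝒢 W → ∫ ω, prim v (X ω - Z ω) ∂P ≤ ∫ ω, prim v (X ω - W ω) ∂P)
    {ε : ℝ} (hε : 0 < ε) : (fun ω => Z ω - (-ε)) ∈ ShortfallSet P 𝒢 v X := by
  classical
  have hY : BddMeas 𝒢 (fun ω => Z ω - (-ε)) := hZ.sub (BddMeas.const 𝒢 (-ε))
  have hc := prim_cont hv
  have iY : Integrable (fun ω => v (X ω - (Z ω - (-ε)))) P :=
    ((hX.sub (hY.mono hG)).comp hv.measurable (locBdd_mono hv)).integrable
  refine ⟨hY, condExp_nonpos_of P hG iY fun A hA => ?_⟩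
  have hW := hY.piecewise hZ hA
  have i1 : Integrable (fun ω => prim v (X ω - Z ω)) P :=
    ((hX.sub (hZ.mono hG)).comp hc.measurable (locBdd_cont hc)).integrable
  have i2 : Integrable (fun ω => prim v (X ω - A.piecewise (fun ω => Z ω - (-ε)) Z ω)) P :=
    ((hX.sub (hW.mono hG)).comp hc.measurable (locBdd_cont hc)).integrable
  have i3 := (iY.indicator (hG _ hA)).mul_const ε
  have h2 : ∫ ω, (prim v (X ω - A.piecewise (fun ω => Z ω - (-ε)) Z ω)
      + A.indicator (fun ω => v (X ω - (Z ω - (-ε)))) ω * ε) ∂P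
      ≤ ∫ ω, prim v (X ω - Z ω) ∂P := by
    refine integral_mono (i2.add i3) i1 fun ω => ?_
    by_cases hω : ω ∈ A
    · have := prim_subgrad hv (X ω - (Z ω - (-ε))) (X ω - Z ω)
      have e : X ω - Z ω - (X ω - (Z ω - (-ε))) = ε := by ring
      rw [e] at this
      simpa [hω] using this
    · simp [hω]
  rw [integral_add i2 i3, integral_mul_const, integral_indicator (hG _ hA)] at h2
  have := h _ hW
  by_contra hcon
  push Not at hcon
  have := mul_pos hcon hε
  linarith

lemma shortfall_lower {mΩ : MeasurableSpace Ω} (P : Measure Ω) [IsProbabilityMeasure P]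
    {𝒢 : MeasurableSpace Ω} (hG : 𝒢 ≤ mΩ) {X Z : Ω → ℝ} (hX : BddMeas mΩ X)
    {v : ℝ → ℝ} (hv : Monotone v) {C x0 : ℝ} (hC : ∀ ω, |X ω| ≤ C) (hx0 : 0 < v x0)
    (hZ : Z ∈ ShortfallSet P 𝒢 v X) : ∀ᵐ ω ∂P, -C - x0 ≤ Z ω := by
  have iZ : Integrable (fun ω => v (X ω - Z ω)) P :=
    ((hX.sub (hZ.1.mono hG)).comp hv.measurable (locBdd_mono hv)).integrable
  have hA : MeasurableSet[𝒢] {ω | Z ω < -C - x0} :=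
    measurableSet_lt hZ.1.1 measurable_const
  have h1 : ∫ ω in {ω | Z ω < -C - x0}, v (X ω - Z ω) ∂P ≤ 0 := by
    rw [← setIntegral_condExp hG iZ hA]
    exact integral_nonpos_of_ae (ae_restrict_of_ae hZ.2)
  have h2 : ∫ ω in {ω | Z ω < -C - x0}, v x0 ∂P
      ≤ ∫ ω in {ω | Z ω < -C - x0}, v (X ω - Z ω) ∂P := by
    refine setIntegral_mono_on (integrable_const _).integrableOn iZ.integrableOn (hG _ hA) ?_
    intro ω hω
    have hω' : Z ω < -C - x0 := hω
    have := (abs_le.1 (hC ω)).1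
    exact hv (by linarith)
  rw [setIntegral_const, smul_eq_mul] at h2
  have h3 : P.real {ω | Z ω < -C - x0} = 0 := by
    by_contra hne
    have hp : 0 < P.real {ω | Z ω < -C - x0} := lt_of_le_of_ne measureReal_nonneg (Ne.symm hne)
    have := mul_pos hp hx0
    linarith
  rw [measureReal_eq_zero_iff] at h3
  rw [ae_iff]
  simpa only [not_le] using h3

/-- there is a minimizer below all acceptable positions -/
lemma exists_argmin {mΩ : MeasurableSpace Ω} (P : Measure Ω) [IsProbabilityMeasure P]
    {𝒢 : MeasurableSpace Ω} (hG : 𝒢 ≤ mΩ) {X : Ω → ℝ} (hX : BddMeas mΩ X)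
    {v : ℝ → ℝ} (hv : Monotone v) (hvneg : ∀ x < (0:ℝ), v x ≤ 0) {x0 : ℝ} (hx0 : 0 < v x0) :
    ∃ Z, BddMeas 𝒢 Z ∧
      (∀ W, BddMeas 𝒢 W → ∫ ω, prim v (X ω - Z ω) ∂P ≤ ∫ ω, prim v (X ω - W ω) ∂P) ∧
      ∀ Y ∈ ShortfallSet P 𝒢 v X, Z ≤ᵐ[P] Y := by
  classical
  obtain ⟨C, hC⟩ := hX.2
  let L := -C - x0
  let M := max (C + 1) L
  let S : Set (Ω → ℝ) := {Z | Z ∈ ShortfallSet P 𝒢 v X ∧ ∀ ω, L ≤ Z ω}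
  have hMS : (fun _ => M) ∈ ShortfallSet P 𝒢 v X := by
    refine ⟨BddMeas.const 𝒢 M, ?_⟩
    have iM : Integrable (fun ω => v (X ω - M)) P :=
      ((hX.sub (BddMeas.const mΩ M)).comp hv.measurable (locBdd_mono hv)).integrable
    refine condExp_nonpos_of P hG iM fun A hA => ?_
    refine integral_nonpos fun ω => hvneg _ ?_
    have := (abs_le.1 (hC ω)).2
    have := le_max_left (C + 1) L
    change X ω - max (C + 1) L < 0
    linarith
  obtain ⟨W, Z, hWS, hWM, hZ, hZW, hWZ, hZle⟩ := exists_essinf P hG S (fun Z hZ => hZ.1.1)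
    (fun Y hY Z hZ => ⟨shortfall_min P hG hX hv hY.1 hZ.1, fun ω => le_min (hY.2 ω) (hZ.2 ω)⟩)
    L M (fun Z hZ => hZ.2) ⟨hMS, fun _ => le_max_right _ _⟩
  have hZall : ∀ Y ∈ ShortfallSet P 𝒢 v X, Z ≤ᵐ[P] Y := by
    intro Y hY
    have hY' : (fun ω => max (Y ω) L) ∈ S :=
      ⟨shortfall_up P hG hX hv hY (hY.1.max (BddMeas.const 𝒢 L)) fun ω => le_max_left _ _,
        fun ω => le_max_right _ _⟩
    filter_upwards [hZle _ hY', shortfall_lower P hG hX hv hC hx0 hY] with ω h1 h2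
    have h1' : Z ω ≤ max (Y ω) L := h1
    rwa [max_eq_left h2] at h1'
  refine ⟨Z, hZ, ?_, hZall⟩
  have hWb : ∀ n ω, |W n ω| ≤ max |L| |M| := fun n ω =>
    abs_le_max_abs_abs ((hWS n).2 ω) (hWM n ω)
  have hWm : ∀ n, Measurable[mΩ] (W n) := fun n => ((hWS n).1.1.mono hG).1
  -- upward direction
  have hup : ∀ V, BddMeas 𝒢 V → (∀ ω, Z ω ≤ V ω) →
      ∫ ω, prim v (X ω - Z ω) ∂P ≤ ∫ ω, prim v (X ω - V ω) ∂P := by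
    intro V hV hle
    obtain ⟨D, hD⟩ := hV.2
    have t1 := tendsto_risk P hX hv hWm hWb hWZ
    have t2 : Tendsto (fun n => ∫ ω, prim v (X ω - max (V ω) (W n ω)) ∂P) atTop
        (𝓝 (∫ ω, prim v (X ω - V ω) ∂P)) := by
      refine tendsto_risk P hX hv (Zn := fun n ω => max (V ω) (W n ω))
        (C := max D (max |L| |M|)) (fun n => (hV.mono hG).1.max (hWm n))
        (fun n ω => abs_max_le_max_abs_abs.trans (max_le_max (hD ω) (hWb n ω))) fun ω => ?_
      have := (tendsto_const_nhds (x := V ω)).max (hWZ ω)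
      rwa [max_eq_left (hle ω)] at this
    refine le_of_tendsto_of_tendsto' t1 t2 fun n => ?_
    refine risk_le P hG hX (hWS n).1.1 (hV.max (hWS n).1.1) hv ?_
    filter_upwards [(hWS n).1.2] with ω hω
    exact mul_nonneg_of_nonpos_of_nonpos hω (sub_nonpos.2 (le_max_right _ _))
  -- downward direction
  have hdown : ∀ V, BddMeas 𝒢 V → (∀ ω, V ω ≤ Z ω) →
      ∫ ω, prim v (X ω - Z ω) ∂P ≤ ∫ ω, prim v (X ω - V ω) ∂P := by
    intro V hV hle
    have tt : ∀ U, BddMeas 𝒢 U →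
        Tendsto (fun n : ℕ => ∫ ω, prim v (X ω - (U ω - 1 / ((n:ℝ) + 1))) ∂P) atTop
        (𝓝 (∫ ω, prim v (X ω - U ω) ∂P)) := by
      intro U hU
      obtain ⟨D, hD⟩ := hU.2
      refine tendsto_risk P hX hv (Zn := fun n ω => U ω - 1 / ((n:ℝ) + 1))
        (C := D + 1) (fun n => (hU.mono hG).1.sub_const _) (fun n ω => ?_) fun ω => ?_
      · refine (abs_sub _ _).trans (add_le_add (hD ω) ?_)
        rw [abs_of_nonneg (by positivity), div_le_one (by positivity)]
        have : (0:ℝ) ≤ n := Nat.cast_nonneg n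
        linarith
      · simpa using (tendsto_const_nhds (x := U ω)).sub
          (tendsto_one_div_add_atTop_nhds_zero_nat (𝕜 := ℝ))
    refine le_of_tendsto_of_tendsto' (tt Z hZ) (tt V hV) fun n => ?_
    have hp : (0:ℝ) < 1 / ((n:ℝ) + 1) := by positivity
    set ε : ℝ := 1 / ((n:ℝ) + 1)
    have hY : BddMeas 𝒢 (fun ω => Z ω - ε) := hZ.sub (BddMeas.const 𝒢 ε)
    refine risk_le P hG hX hY (hV.sub (BddMeas.const 𝒢 ε)) hv ?_
    have hA : MeasurableSet[𝒢] {ω | (P[fun ω' => v (X ω' - (Z ω' - ε))|𝒢]) ω ≤ 0} :=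
      measurableSet_le stronglyMeasurable_condExp.measurable measurable_const
    have hm := paste P hG hX hv hY hMS hA (Eventually.of_forall fun ω h => h)
    filter_upwards [hZall _ hm] with ω hω
    refine mul_nonneg ?_ (by linarith [hle ω])
    by_contra hcon
    push Not at hcon
    rw [Set.piecewise_eq_of_mem _ _ _ (show ω ∈ {ω | (P[fun ω' => v (X ω' - (Z ω' - ε))|𝒢]) ω ≤ 0} from hcon.le)] at hω
    linarith
  intro V hV
  have h1 := hup _ (hV.max hZ) fun ω => le_max_right _ _
  have h2 := hdown _ (hV.min hZ) fun ω => min_le_right _ _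
  have hc := prim_cont hv
  have ii : ∀ U, BddMeas 𝒢 U → Integrable (fun ω => prim v (X ω - U ω)) P := fun U hU =>
    ((hX.sub (hU.mono hG)).comp hc.measurable (locBdd_cont hc)).integrable
  have h3 : ∫ ω, prim v (X ω - max (V ω) (Z ω)) ∂P + ∫ ω, prim v (X ω - min (V ω) (Z ω)) ∂P
      = ∫ ω, prim v (X ω - V ω) ∂P + ∫ ω, prim v (X ω - Z ω) ∂P := by
    rw [← integral_add (ii _ (hV.max hZ)) (ii _ (hV.min hZ)), ← integral_add (ii _ hV) (ii _ hZ)]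
    congr 1
    ext ω
    rcases le_total (V ω) (Z ω) with h | h
    · rw [max_eq_right h, min_eq_left h, add_comm]
    · rw [max_eq_left h, min_eq_right h]
  linarith

/-- Theorem 4.1 (ii): for `v` increasing with `v(0−) ≤ 0 ≤ v(0+)`
(equivalently, `v ≤ 0` on `(−∞,0)` and `v ≥ 0` on `(0,∞)`), the conditional shortfall risk
measure coincides a.s. with the conditional generalized quantile built from
`u1(x) = (1/α)·∫_0^x v(t) dt` and `u2(x) = −(1/(1−α))·∫_{−x}^0 v(t) dt`. -/
theorem conditional_shortfall_eq_generalized_quantile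
    [mΩ : MeasurableSpace Ω] (P : Measure Ω) [IsProbabilityMeasure P]
    (hP : Nonatomic P) (𝒢 : MeasurableSpace Ω) (hG : 𝒢 ≤ mΩ)
    (X : Ω → ℝ) (hX : BddMeas mΩ X)
    (v : ℝ → ℝ) (hv : Monotone v)
    (hvneg : ∀ x < (0:ℝ), v x ≤ 0) (hvpos : ∀ x > (0:ℝ), 0 ≤ v x)
    {α : ℝ} (hα : α ∈ Set.Ioo (0:ℝ) 1)
    (ρv ρa : Ω → ℝ)
    (hρv : IsEssInf P (ShortfallSet P 𝒢 v X) ρv)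
    (hρa : IsEssInf P (ArgminSet P 𝒢
        (fun x => (1 / α) * ∫ t in (0:ℝ)..x, v t)
        (fun x => -(1 / (1 - α)) * ∫ t in (-x)..(0:ℝ), v t) α X) ρa) :
    ρv =ᵐ[P] ρa := by
  have hmem : ∀ Z, Z ∈ ArgminSet P 𝒢 (fun x => (1 / α) * ∫ t in (0:ℝ)..x, v t)
        (fun x => -(1 / (1 - α)) * ∫ t in (-x)..(0:ℝ), v t) α X ↔ BddMeas 𝒢 Z ∧
      ∀ W, BddMeas 𝒢 W → ∫ ω, prim v (X ω - Z ω) ∂P ≤ ∫ ω, prim v (X ω - W ω) ∂P := by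
    intro Z
    unfold ArgminSet
    rw [mem_ofPred_eq]
    refine and_congr_right fun hZ => forall_congr' fun W => forall_congr' fun hW => ?_
    rw [piRisk_eq P hX (hZ.mono hG) hv hα, piRisk_eq P hX (hW.mono hG) hv hα]
  have hex : ∃ x0, 0 < v x0 := by
    by_contra hcon
    push Not at hcon
    have hall : ∀ n : ℕ, ρv ≤ᵐ[P] fun _ => -(n:ℝ) := by
      intro n
      refine hρv.1 _ ⟨BddMeas.const 𝒢 _, ?_⟩
      refine condExp_nonpos_of P hG
        ((hX.sub (BddMeas.const mΩ _)).comp hv.measurable (locBdd_mono hv)).integrable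
        fun A hA => ?_
      exact integral_nonpos fun ω => hcon _
    obtain ⟨ω, hω⟩ := (ae_all_iff.2 hall).exists
    obtain ⟨n, hn⟩ := exists_nat_gt (-(ρv ω))
    have := hω n
    linarith
  obtain ⟨x0, hx0⟩ := hex
  have h1 : ρv ≤ᵐ[P] ρa := by
    refine hρa.2 _ fun Z hZ => ?_
    rw [hmem] at hZ
    have hn : ∀ n : ℕ, ρv ≤ᵐ[P] fun ω => Z ω - (-(1 / ((n:ℝ) + 1))) := fun n =>
      hρv.1 _ (argmin_add_mem P hG hX hv hZ.1 hZ.2 (by positivity))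
    filter_upwards [ae_all_iff.2 hn] with ω hω
    have ht : Tendsto (fun n : ℕ => Z ω - (-(1 / ((n:ℝ) + 1)))) atTop (𝓝 (Z ω)) := by
      simpa using (tendsto_const_nhds (x := Z ω)).sub
          (tendsto_one_div_add_atTop_nhds_zero_nat (𝕜 := ℝ)).neg
    exact ge_of_tendsto' ht hω
  have h2 : ρa ≤ᵐ[P] ρv := by
    obtain ⟨Z, hZ, hZm, hZl⟩ := exists_argmin P hG hX hv hvneg hx0
    exact (hρa.1 Z ((hmem Z).2 ⟨hZ, hZm⟩)).trans (hρv.2 Z hZl)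
  filter_upwards [h1, h2] with ω a b using le_antisymm a b
end

section
/- Let (Ω,F,P) be a non-atomic probability space, G ⊆ F a sub-σ-algebra, u1, u2 ∈ U⁺_icx and α ∈ (0,1). The conditional generalized quantile ρ_α^G is conditionally translation invariant: for all X ∈ L∞(F) and H ∈ L∞(G), ρ_α^G(X + H) = ρ_α^G(X) + H P-a.s. -/
open MeasureTheory Set Filter Topology

variable {Ω : Type*}

/-- Proposition 5.1 (iii): the conditional generalized quantile is
conditionally translation invariant: for `H ∈ L∞(𝒢)`, `ρ_α^𝒢(X+H) = ρ_α^𝒢(X) + H` a.s. -/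
theorem conditional_generalized_quantile_translation_invariant
    [mΩ : MeasurableSpace Ω] (P : Measure Ω) [IsProbabilityMeasure P]
    (hP : Nonatomic P) (𝒢 : MeasurableSpace Ω) (hG : 𝒢 ≤ mΩ)
    {u1 u2 : ℝ → ℝ} (h1 : Uicx u1) (h2 : Uicx u2)
    {α : ℝ} (hα : α ∈ Set.Ioo (0:ℝ) 1)
    (X : Ω → ℝ) (hX : BddMeas mΩ X)
    (H : Ω → ℝ) (hH : BddMeas 𝒢 H)
    (ρXH ρX : Ω → ℝ)
    (hρXH : IsEssInf P (ArgminSet P 𝒢 u1 u2 α (fun ω => X ω + H ω)) ρXH)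
    (hρX : IsEssInf P (ArgminSet P 𝒢 u1 u2 α X) ρX) :
    ρXH =ᵐ[P] fun ω => ρX ω + H ω := by
  have shift : ∀ Y K Z : Ω → ℝ, BddMeas 𝒢 K → Z ∈ ArgminSet P 𝒢 u1 u2 α Y →
      (fun ω => Z ω + K ω) ∈ ArgminSet P 𝒢 u1 u2 α (fun ω => Y ω + K ω) := by
    rintro Y K Z ⟨hKm, C, hC⟩ ⟨⟨hZm, D, hD⟩, hmin⟩
    refine ⟨⟨hZm.add hKm, D + C, fun ω => (abs_add_le _ _).trans (add_le_add (hD ω) (hC ω))⟩, ?_⟩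
    rintro W ⟨hWm, E, hE⟩
    have h := hmin (fun ω => W ω - K ω)
      ⟨hWm.sub hKm, E + C, fun ω => (abs_sub _ _).trans (add_le_add (hE ω) (hC ω))⟩
    have e1 : piRisk P u1 u2 α (fun ω => Y ω + K ω) (fun ω => Z ω + K ω)
        = piRisk P u1 u2 α Y Z := by
      simp only [piRisk, add_sub_add_right_eq_sub]
    have e2 : piRisk P u1 u2 α (fun ω => Y ω + K ω) W
        = piRisk P u1 u2 α Y (fun ω => W ω - K ω) := by
      have a1 : ∀ ω, Y ω + K ω - W ω = Y ω - (W ω - K ω) := fun ω => by ring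
      have a2 : ∀ ω, W ω - (Y ω + K ω) = W ω - K ω - Y ω := fun ω => by ring
      simp only [piRisk, a1, a2]
    rw [e1, e2]
    exact h
  have hnH : BddMeas 𝒢 (fun ω => -H ω) := by
    obtain ⟨hm, C, hC⟩ := hH
    exact ⟨hm.neg, C, fun ω => by simpa using hC ω⟩
  have hle : ρXH ≤ᵐ[P] fun ω => ρX ω + H ω := by
    have h := hρX.2 (fun ω => ρXH ω - H ω) (fun Z hZ => by
      filter_upwards [hρXH.1 _ (shift X H Z hH hZ)] with ω hω
      linarith)
    filter_upwards [h] with ω hω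
    linarith
  have hge : (fun ω => ρX ω + H ω) ≤ᵐ[P] ρXH := by
    refine hρXH.2 _ (fun Z hZ => ?_)
    have hs := shift _ (fun ω => -H ω) Z hnH hZ
    simp only [add_neg_cancel_right] at hs
    filter_upwards [hρX.1 _ hs] with ω hω
    linarith
  exact hle.antisymm hge
end
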